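/- arXiv:1411.2078 — 2 statements merged into one kernel-verified Lean document; each statement's English description precedes it below -/
import Mathlib

section
/- Ramanujan identities for Γ₀(3): set E₃(τ) = (3E₂(3τ)+E₂(τ))/4. Then for every τ in the complex upper half-plane, (1/2πi)·dA₃/dτ = (1/6)(A₃(τ)E₃(τ) + C₃(τ)³ − B₃(τ)³), (1/2πi)·dB₃/dτ = (1/6)·B₃(τ)·(E₃(τ) − A₃(τ)²), (1/2πi)·dC₃/dτ = (1/6)·C₃(τ)·(E₃(τ) + A₃(τ)²), and (1/2πi)·dE₃/dτ = (1/6)(E₃(τ)² − A₃(τ)⁴). -/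
noncomputable def A3 (τ : ℂ) : ℂ :=
  ∑' p : ℤ × ℤ, Complex.exp (2 * Real.pi * Complex.I *
    ((p.1 : ℂ)^2 + (p.1 : ℂ) * (p.2 : ℂ) + (p.2 : ℂ)^2) * τ)

noncomputable def B3 (τ : ℂ) : ℂ :=
  ∑' p : ℤ × ℤ, Complex.exp (2 * Real.pi * Complex.I * ((p.1 : ℂ) - (p.2 : ℂ)) / 3) *
    Complex.exp (2 * Real.pi * Complex.I *
      ((p.1 : ℂ)^2 + (p.1 : ℂ) * (p.2 : ℂ) + (p.2 : ℂ)^2) * τ)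

noncomputable def C3 (τ : ℂ) : ℂ :=
  ∑' p : ℤ × ℤ, Complex.exp (2 * Real.pi * Complex.I *
    ((p.1 : ℂ)^2 + (p.1 : ℂ) * (p.2 : ℂ) + (p.2 : ℂ)^2 + (p.1 : ℂ) + (p.2 : ℂ) + 1/3) * τ)
noncomputable def E2 (τ : ℂ) : ℂ :=
  1 - 24 * ∑' n : ℕ, (∑ d ∈ Nat.divisors (n + 1), (d : ℂ)) *
    Complex.exp (2 * Real.pi * Complex.I * ((n : ℂ) + 1) * τ)

noncomputable def E3quasi (τ : ℂ) : ℂ := (3 * E2 (3 * τ) + E2 τ) / 4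

namespace RamanujanGamma0Three

section

open Complex Filter Topology Function

section ExponentialSeries

variable {ι : Type*} {c : ι → ℂ} {r : ι → ℝ}

lemma norm_cexp_two_pi_mul (r : ℝ) (τ : ℂ) :
    ‖cexp (2 * Real.pi * I * r * τ)‖ = Real.exp (-2 * Real.pi * r * τ.im) := by
  rw [norm_exp]
  congr 1
  simp

lemma norm_mul_cexp_le (hr : ∀ i, 0 ≤ r i) {ε : ℝ} {τ : ℂ} (hτ : ε ≤ τ.im) (i : ι) :
    ‖c i * cexp (2 * Real.pi * I * r i * τ)‖ ≤ ‖c i‖ * Real.exp (-2 * Real.pi * r i * ε) := by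
  rw [norm_mul, norm_cexp_two_pi_mul]
  have := mul_le_mul_of_nonneg_left hτ (mul_nonneg Real.two_pi_pos.le (hr i))
  gcongr ‖c i‖ * Real.exp ?_
  linarith

theorem differentiableOn_tsum_cexp (hr : ∀ i, 0 ≤ r i)
    (hs : ∀ ε > 0, Summable fun i ↦ ‖c i‖ * Real.exp (-2 * Real.pi * r i * ε)) :
    DifferentiableOn ℂ (fun τ ↦ ∑' i, c i * cexp (2 * Real.pi * I * r i * τ)) {τ | 0 < τ.im} := by
  intro τ hτ
  have hτ' : 0 < τ.im / 2 := half_pos hτ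
  have ho : IsOpen {w : ℂ | τ.im / 2 < w.im} := isOpen_lt continuous_const continuous_im
  refine ((differentiableOn_tsum_of_summable_norm (hs _ hτ') (fun i ↦ ?_) ho fun i w hw ↦
    norm_mul_cexp_le hr (le_of_lt hw) i).differentiableAt
      (ho.mem_nhds (show τ.im / 2 < τ.im from half_lt_self hτ))).differentiableWithinAt
  fun_prop

theorem tendsto_tsum_cexp (hr : ∀ i, 0 ≤ r i)
    (hs : ∀ ε > 0, Summable fun i ↦ ‖c i‖ * Real.exp (-2 * Real.pi * r i * ε)) :
    Tendsto (fun τ ↦ ∑' i, c i * cexp (2 * Real.pi * I * r i * τ)) (comap im atTop)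
      (𝓝 (∑' i, if r i = 0 then c i else 0)) := by
  refine tendsto_tsum_of_dominated_convergence (hs 1 one_pos) (fun i ↦ ?_) ?_
  · split_ifs with h
    · simp [h, tendsto_const_nhds]
    · rw [tendsto_zero_iff_norm_tendsto_zero]
      simp only [norm_mul, norm_cexp_two_pi_mul]
      have hpos : 0 < 2 * Real.pi * r i :=
        mul_pos Real.two_pi_pos (lt_of_le_of_ne (hr i) (Ne.symm h))
      have : Tendsto (fun y : ℝ ↦ ‖c i‖ * Real.exp (-(2 * Real.pi * r i * y))) atTop
          (𝓝 (‖c i‖ * 0)) :=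
        (Real.tendsto_exp_neg_atTop_nhds_zero.comp
          (tendsto_id.const_mul_atTop hpos)).const_mul _
      simpa [Function.comp_def] using this.comp (tendsto_comap (f := im))
  · filter_upwards [preimage_mem_comap (Ici_mem_atTop (1 : ℝ))] with τ hτ i
    exact norm_mul_cexp_le hr hτ i

end ExponentialSeries

theorem tendsto_deriv_comap_im_atTop {f : ℂ → ℂ} {a : ℂ}
    (hf : DifferentiableOn ℂ f {τ | 0 < τ.im}) (ha : Tendsto f (comap im atTop) (𝓝 a)) :
    Tendsto (deriv f) (comap im atTop) (𝓝 0) := by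
  rw [Metric.tendsto_nhds]
  intro ε hε
  have h := Metric.tendsto_nhds.mp ha (ε / 2) (half_pos hε)
  rw [eventually_comap, eventually_atTop] at h ⊢
  obtain ⟨Y, hY⟩ := h
  refine ⟨max (Y + 1) 2, fun y hy τ hτ ↦ ?_⟩
  have hball : ∀ w ∈ Metric.closedBall τ 1, Y ≤ w.im ∧ 0 < w.im := by
    intro w hw
    have h1 : |(w - τ).im| ≤ 1 := (abs_im_le_norm _).trans (by simpa [dist_eq] using hw)
    rw [sub_im, abs_le] at h1
    have h2 := le_max_left (Y + 1) 2
    have h3 := le_max_right (Y + 1) 2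
    constructor <;> linarith
  have hd : DiffContOnCl ℂ (fun w ↦ f w - a) (Metric.ball τ 1) := by
    refine DifferentiableOn.diffContOnCl ?_
    rw [closure_ball τ one_ne_zero]
    exact (hf.mono fun w hw ↦ (hball w hw).2).sub_const a
  have := norm_deriv_le_of_forall_mem_sphere_norm_le one_pos hd (C := ε / 2) fun w hw ↦ by
    have := hY w.im (hball w (Metric.sphere_subset_closedBall hw)).1 w rfl
    rw [dist_eq] at this
    exact this.le
  rw [deriv_sub_const] at this
  rw [dist_zero_right]
  linarith

lemma summable_exp_neg_mul_sq {a : ℝ} (ha : 0 < a) :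
    Summable fun n : ℤ ↦ Real.exp (-a * (n : ℝ) ^ 2) := by
  have h := ((summable_jacobiTheta₂_term_iff 0 (a / Real.pi * I)).mpr
    (by simpa using div_pos ha Real.pi_pos)).norm
  refine h.congr fun n ↦ ?_
  rw [norm_jacobiTheta₂_term]
  congr 1
  have := Real.pi_ne_zero
  rw [← ofReal_div, im_ofReal_mul, I_im]
  simp
  field_simp

end

section

open Complex Filter Topology Asymptotics UpperHalfPlane ModularForm
open scoped MatrixGroups Manifold

theorem eq_zero_of_level_one {P : ℂ → ℂ} {n : ℕ} (hd : DifferentiableOn ℂ P {τ | 0 < τ.im})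
    (hT : ∀ τ : ℂ, 0 < τ.im → P (τ + 1) = P τ)
    (hS : ∀ τ : ℂ, 0 < τ.im → P (-1 / τ) = (τ ^ 12) ^ n * P τ)
    (ho : P =o[comap Complex.im atTop] fun τ ↦ Real.exp (-2 * Real.pi * τ.im) ^ n) :
    ∀ τ : ℂ, 0 < τ.im → P τ = 0 := by
  let Φ : ℍ → ℂ := fun z ↦ P z / discriminant z ^ n
  have hΔT (z : ℍ) : discriminant (ModularGroup.T • z) = discriminant z := by
    have := congrFun discriminant_T_invariant z
    rw [SL_slash_apply] at this
    have hden : denom ModularGroup.T z = 1 := by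
      rw [ModularGroup.denom_apply]
      simp [ModularGroup.T]
    rw [hden, one_zpow, mul_one] at this
    exact this
  have hΔS (z : ℍ) : discriminant (ModularGroup.S • z) = (z : ℂ) ^ 12 * discriminant z := by
    have := congrFun discriminant_S_invariant z
    rw [SL_slash_apply, ModularGroup.denom_S] at this
    rw [zpow_neg, ← div_eq_mul_inv, div_eq_iff (zpow_ne_zero 12 (ne_zero z))] at this
    rw [this, mul_comm, zpow_ofNat]
  have hinv : ∀ γ : SL(2, ℤ), Φ ∣[(0 : ℤ)] γ = Φ := by
    refine SlashInvariantForm.slash_action_generators_SL2Z ?_ ?_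
    · ext z
      have hz := pow_ne_zero n (pow_ne_zero 12 (ne_zero z))
      have hz' := hS z z.im_pos
      simp only [SL_slash_apply, Φ, hΔS, neg_zero, zpow_zero, mul_one, mul_pow]
      rw [modular_S_smul]
      rw [show ((UpperHalfPlane.mk (-(z : ℂ))⁻¹ z.im_inv_neg_coe_pos : ℍ) : ℂ) = -1 / z by
        simp [neg_div, inv_neg], hz', mul_div_mul_left _ _ hz]
    · ext z
      simp only [SL_slash_apply, Φ, hΔT, neg_zero, zpow_zero, mul_one]
      rw [modular_T_smul, coe_vadd]
      simp [add_comm (1 : ℂ), hT z z.im_pos]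
  have hlim : Tendsto Φ atImInfty (𝓝 0) := by
    have h1 : (fun z : ℍ ↦ P z) =o[atImInfty] fun z ↦ discriminant z ^ n :=
      (ho.comp_tendsto tendsto_coe_atImInfty).trans_isBigO (exp_isBigO_discriminant.pow n)
    exact h1.tendsto_div_nhds_zero
  let F : ModularForm 𝒮ℒ 0 :=
    { toFun := Φ
      slash_action_eq' := fun _ ⟨γ, hγ⟩ ↦ hγ ▸ hinv γ
      holo' := by
        have hP : MDiff fun z : ℍ ↦ P z := by
          rw [UpperHalfPlane.mdifferentiable_iff]
          exact hd.congr fun z hz ↦ by simp [ofComplex_apply_of_im_pos hz]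
        exact hP.div (CuspForm.discriminant.holo'.pow n) fun z ↦
          pow_ne_zero n (discriminant_ne_zero z)
      bdd_at_cusps' := fun {c} hc ↦ by
        rw [Subgroup.IsArithmetic.isCusp_iff_isCusp_SL2Z] at hc
        rw [OnePoint.isBoundedAt_iff_forall_SL2Z hc]
        intro γ _
        rw [hinv γ]
        exact hlim.isBigO_one ℝ }
  obtain ⟨a, ha⟩ := ModularFormClass.levelOne_weight_zero_const F
  have hΦ : Φ = Function.const _ a := ha
  have ha0 : a = 0 := tendsto_nhds_unique (by rw [hΦ]; exact tendsto_const_nhds) hlim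
  intro τ hτ
  have := congrFun hΦ ⟨τ, hτ⟩
  rw [ha0, Function.const_apply, div_eq_zero_iff] at this
  exact this.resolve_right (pow_ne_zero n (discriminant_ne_zero _))

lemma analyticOnNhd_of_differentiableOn {f : ℂ → ℂ}
    (hf : DifferentiableOn ℂ f {τ | 0 < τ.im}) : AnalyticOnNhd ℂ f {τ | 0 < τ.im} :=
  hf.analyticOnNhd (isOpen_lt continuous_const continuous_im)

lemma eq_zero_or_eq_zero_of_mul_eq_zero {f g : ℂ → ℂ}
    (hf : DifferentiableOn ℂ f {τ | 0 < τ.im}) (hg : DifferentiableOn ℂ g {τ | 0 < τ.im})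
    (h : ∀ τ : ℂ, 0 < τ.im → f τ * g τ = 0) :
    (∀ τ : ℂ, 0 < τ.im → f τ = 0) ∨ ∀ τ : ℂ, 0 < τ.im → g τ = 0 :=
  AnalyticOnNhd.eq_zero_or_eq_zero_of_mul_eq_zero (analyticOnNhd_of_differentiableOn hf)
    (analyticOnNhd_of_differentiableOn hg) h (convex_halfSpace_im_gt 0).isPreconnected

lemma im_div_three (τ : ℂ) : (τ / 3).im = τ.im / 3 := by
  simp

lemma im_neg_one_div_three_mul_pos {τ : ℂ} (hτ : 0 < τ.im) : 0 < (-1 / (3 * τ)).im := by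
  have h0 : 0 < normSq τ := normSq_pos.mpr fun h ↦ by simp [h] at hτ
  have : (-1 / (3 * τ)).im = τ.im / (3 * normSq τ) := by
    rw [neg_div, one_div, neg_im, inv_im, normSq_mul, mul_im]
    simp
    field_simp
  rw [this]
  positivity

theorem eq_zero_of_fricke {H : ℂ → ℂ} {m : ℕ} (hd : DifferentiableOn ℂ H {τ | 0 < τ.im})
    (hT : ∀ τ : ℂ, 0 < τ.im → H (τ + 1) = H τ)
    (hW : ∀ τ : ℂ, 0 < τ.im → H (-1 / (3 * τ)) = (3 ^ 6 * τ ^ 12) ^ m * H τ)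
    (ho : H =o[comap Complex.im atTop] fun τ ↦ Real.exp (-4 * Real.pi * m * τ.im)) :
    ∀ τ : ℂ, 0 < τ.im → H τ = 0 := by
  have him (τ : ℂ) (j : ℕ) : ((τ + j) / 3).im = τ.im / 3 := by
    simp
  have hpar {u s : ℂ} (hu : 0 < u.im) (hs : 0 < s.im) (h : H s = H (-1 / (3 * u))) :
      H (-1 / (3 * s)) = (3 ^ 12 * (s * u) ^ 12) ^ m * H u := by
    rw [hW s hs, h, hW u hu, ← mul_assoc, ← mul_pow]
    ring
  let G : ℕ → ℂ → ℂ := fun j τ ↦ H ((τ + j) / 3)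
  let P : ℂ → ℂ := fun τ ↦ H τ * (G 0 τ * G 1 τ * G 2 τ)
  have hGd (j : ℕ) : DifferentiableOn ℂ (G j) {τ | 0 < τ.im} :=
    hd.comp (by fun_prop) fun τ hτ ↦ by
      rw [Set.mem_ofPred_eq] at hτ ⊢; rw [him]; positivity
  have hPd : DifferentiableOn ℂ P {τ | 0 < τ.im} :=
    hd.mul (((hGd 0).mul (hGd 1)).mul (hGd 2))
  have hGo (j : ℕ) : G j =o[comap Complex.im atTop]
      fun τ ↦ Real.exp (-4 * Real.pi * m * (τ.im / 3)) := by
    have ht : Tendsto (fun τ : ℂ ↦ (τ + j) / 3) (comap Complex.im atTop)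
        (comap Complex.im atTop) := by
      rw [tendsto_comap_iff]
      simp only [Function.comp_def, him]
      exact tendsto_comap.atTop_div_const (by norm_num)
    simpa [Function.comp_def, him] using ho.comp_tendsto ht
  have hP := eq_zero_of_level_one (P := P) (n := 4 * m) hPd ?_ ?_ ?_
  · have hG {j : ℕ} (h : ∀ τ : ℂ, 0 < τ.im → G j τ = 0) : ∀ τ : ℂ, 0 < τ.im → H τ = 0 := by
      intro τ hτ
      simpa [G] using h (3 * τ - j) (by simpa using hτ)
    rcases eq_zero_or_eq_zero_of_mul_eq_zero hd (((hGd 0).mul (hGd 1)).mul (hGd 2)) hP with h | h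
    · exact h
    rcases eq_zero_or_eq_zero_of_mul_eq_zero ((hGd 0).mul (hGd 1)) (hGd 2) h with h | h
    · rcases eq_zero_or_eq_zero_of_mul_eq_zero (hGd 0) (hGd 1) h with h | h <;> exact hG h
    · exact hG h
  · intro τ hτ
    have h3 : H ((τ + 3) / 3) = H (τ / 3) := by
      rw [add_div, div_self (by norm_num), hT _ (by rw [im_div_three]; positivity)]
    simp only [P, G, hT τ hτ]
    norm_num only [add_assoc, Nat.cast_ofNat, Nat.cast_zero, Nat.cast_one, add_zero]
    rw [h3]
    ring
  · intro τ hτ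
    have hτ0 : τ ≠ 0 := fun h ↦ by simp [h] at hτ
    have h0 : H (-1 / τ) = (3 ^ 6 * (τ / 3) ^ 12) ^ m * H (τ / 3) := by
      rw [← hW (τ / 3) (by rw [im_div_three]; positivity),
        mul_div_cancel₀ τ (by norm_num)]
    have h1 : H (-1 / τ / 3) = (3 ^ 6 * τ ^ 12) ^ m * H τ := by
      rw [← hW τ hτ, div_div, mul_comm τ]
    have hne {a : ℂ} (ha : a.im = 0) : τ + a ≠ 0 := fun h ↦ by
      have := congrArg Complex.im h
      simp [ha, hτ.ne'] at this
    have h2 : H ((-1 / τ + 1) / 3) = (τ ^ 12) ^ m * H ((τ + 2) / 3) := by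
      have hu : 0 < ((τ + 2) / 3 - 1).im := by
        simpa [im_div_three] using hτ
      have hne1 : τ - 1 ≠ 0 := by simpa [sub_eq_add_neg] using hne (a := -1) (by simp)
      have hs : -1 / (3 * ((τ + 2) / 3 - 1)) - 1 = -τ / (τ - 1) := by
        rw [show 3 * ((τ + 2) / 3 - 1) = τ - 1 by ring]
        field_simp
        ring
      have him_s : 0 < (-1 / (3 * ((τ + 2) / 3 - 1)) - 1).im := by
        simpa using im_neg_one_div_three_mul_pos hu
      have := hpar hu him_s (by rw [← hT _ him_s, sub_add_cancel])
      rw [hs] at this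
      rw [← sub_add_cancel ((τ + 2) / 3) 1, hT _ hu]
      have harg : -1 / (3 * (-τ / (τ - 1))) = (-1 / τ + 1) / 3 := by
        field_simp
        ring
      have hfac : -τ / (τ - 1) * ((τ + 2) / 3 - 1) = -τ / 3 := by
        field_simp
        ring
      rw [harg, hfac] at this
      rw [this]
      congr 2
      ring
    have h3 : H ((-1 / τ + 2) / 3) = (τ ^ 12) ^ m * H ((τ + 1) / 3) := by
      have hu : 0 < ((τ + 1) / 3).im := by
        simpa [im_div_three] using hτ
      have hne1 : τ + 1 ≠ 0 := hne (by simp)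
      have hs : -1 / (3 * ((τ + 1) / 3)) + 1 = τ / (τ + 1) := by
        field_simp
        ring
      have him_s : 0 < (-1 / (3 * ((τ + 1) / 3)) + 1).im := by
        simpa using im_neg_one_div_three_mul_pos hu
      have hW' := hpar hu him_s (hT _ (im_neg_one_div_three_mul_pos hu))
      have him_W := im_neg_one_div_three_mul_pos him_s
      have harg : -1 / (3 * (τ / (τ + 1))) + 1 = (-1 / τ + 2) / 3 := by
        field_simp
        ring
      have hfac : τ / (τ + 1) * ((τ + 1) / 3) = τ / 3 := by
        field_simp
      rw [← hT _ him_W, hs, harg, hfac] at hW'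
      rw [hW']
      congr 2
      ring
    simp only [P, G, Nat.cast_ofNat, Nat.cast_zero, Nat.cast_one, add_zero, h0, h1, h2, h3]
    rw [show (τ ^ 12) ^ (4 * m) = (3 ^ 6 * (τ / 3) ^ 12) ^ m * (3 ^ 6 * τ ^ 12) ^ m *
      (τ ^ 12) ^ m * (τ ^ 12) ^ m by
        rw [pow_mul, ← mul_pow, ← mul_pow, ← mul_pow]; congr 1; ring]
    ring
  · refine (ho.mul (((hGo 0).mul (hGo 1)).mul (hGo 2))).congr_right fun τ ↦ ?_
    rw [← Real.exp_add, ← Real.exp_add, ← Real.exp_add, ← Real.exp_nat_mul]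
    congr 1
    push_cast
    ring

end

section

open Complex Filter Topology

lemma summable_exp_of_quadratic_le {r : ℤ × ℤ → ℝ} {a ε : ℝ} (hε : 0 < ε)
    (hr : ∀ p : ℤ × ℤ, ((p.1 : ℝ) ^ 2 + (p.2 : ℝ) ^ 2) / 4 - a ≤ r p) :
    Summable fun p ↦ Real.exp (-2 * Real.pi * r p * ε) := by
  have hπε : 0 < Real.pi * ε := mul_pos Real.pi_pos hε
  have h1 := summable_exp_neg_mul_sq (half_pos hπε)
  have h2 := (h1.mul_of_nonneg h1 (fun _ ↦ (Real.exp_pos _).le)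
    fun _ ↦ (Real.exp_pos _).le).mul_left (Real.exp (2 * (Real.pi * ε) * a))
  refine h2.of_nonneg_of_le (fun _ ↦ (Real.exp_pos _).le) fun p ↦ ?_
  rw [← Real.exp_add, ← Real.exp_add, Real.exp_le_exp]
  have := mul_le_mul_of_nonneg_left (hr p) hπε.le
  linarith

lemma cpow_half_mul_cpow_half {τ : ℂ} (hτ : τ ≠ 0) :
    (-I * (2 * τ)) ^ (1 / 2 : ℂ) * (-I * (3 * τ / 2)) ^ (1 / 2 : ℂ) = -I * √3 * τ := by
  have h2 : -I * (2 * τ) = ((2 : ℝ) : ℂ) * (-I * τ) := by push_cast; ring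
  have h3 : -I * (3 * τ / 2) = ((3 / 2 : ℝ) : ℂ) * (-I * τ) := by push_cast; ring
  rw [h2, h3]
  have hx : -I * τ ≠ 0 := mul_ne_zero (neg_ne_zero.mpr I_ne_zero) hτ
  have hmul {r : ℝ} (hr : 0 < r) :
      ((r : ℂ) * (-I * τ)) ^ (1 / 2 : ℂ) = (√r : ℂ) * (-I * τ) ^ (1 / 2 : ℂ) := by
    rw [cpow_def_of_ne_zero (mul_ne_zero (ofReal_ne_zero.mpr hr.ne') hx), log_ofReal_mul hr hx,
      add_mul, exp_add, ← cpow_def_of_ne_zero hx, Real.sqrt_eq_rpow, ofReal_cpow hr.le,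
      cpow_def_of_ne_zero (ofReal_ne_zero.mpr hr.ne'), ofReal_log hr.le]
    norm_num
  rw [hmul two_pos, hmul (by norm_num : (0 : ℝ) < 3 / 2), mul_mul_mul_comm,
    ← cpow_add _ _ hx, ← ofReal_mul, ← Real.sqrt_mul zero_le_two]
  norm_num
  ring

/-- Poisson summation for the hexagonal lattice with a real character. -/
theorem tsum_hexagonal_inversion (u v : ℝ) {τ : ℂ} (hτ : 0 < τ.im) :
    ∑' p : ℤ × ℤ, cexp (2 * Real.pi * I * (p.1 * u + p.2 * v)) *
        cexp (2 * Real.pi * I * ((p.1 : ℂ) ^ 2 + p.1 * p.2 + (p.2 : ℂ) ^ 2) * τ) =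
      (-I * √3 * τ)⁻¹ * ∑' p : ℤ × ℤ, cexp (2 * Real.pi * I *
        ((p.1 - u : ℂ) ^ 2 - (p.1 - u) * (p.2 - v) + (p.2 - v : ℂ) ^ 2) * (-1 / (3 * τ))) := by
  have hτ0 : τ ≠ 0 := fun h ↦ by simp [h] at hτ
  have hσ : 0 < (-1 / (3 * τ)).im := im_neg_one_div_three_mul_pos hτ
  let K : ℤ → ℤ → ℂ := fun n k ↦ cexp (-Real.pi * I * u ^ 2 / (2 * τ)) *
    (jacobiTheta₂_term k (u / (2 * τ)) (-1 / (2 * τ)) *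
      jacobiTheta₂_term n ((2 * v - u + k) / 2) (3 * τ / 2))
  let L : ℤ → ℤ → ℂ := fun k l ↦ cexp (2 * Real.pi * I *
        ((k - u : ℂ) ^ 2 - (k - u) * (l - v) + (l - v : ℂ) ^ 2) * (-1 / (3 * τ)))
  have hF : Summable fun p : ℤ × ℤ ↦ cexp (2 * Real.pi * I * (p.1 * u + p.2 * v)) *
      cexp (2 * Real.pi * I * ((p.1 : ℂ) ^ 2 + p.1 * p.2 + (p.2 : ℂ) ^ 2) * τ) := by
    refine Summable.of_norm ((summable_exp_of_quadratic_le (a := 0)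
      (r := fun p ↦ (p.1 : ℝ) ^ 2 + p.1 * p.2 + (p.2 : ℝ) ^ 2) hτ fun p ↦ ?_).congr fun p ↦ ?_)
    · nlinarith [sq_nonneg ((p.1 : ℝ) + p.2), sq_nonneg (p.1 : ℝ), sq_nonneg (p.2 : ℝ)]
    · rw [norm_mul, ← norm_cexp_two_pi_mul]
      have : ‖cexp (2 * Real.pi * I * (p.1 * u + p.2 * v))‖ = 1 := by
        rw [norm_exp]
        simp
      rw [this, one_mul]
      push_cast
      rfl
  have hK : Summable (Function.uncurry K) := by
    have h1 : 0 < (-1 / (2 * τ)).im := by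
      have : (-1 / (2 * τ)).im = 3 / 2 * (-1 / (3 * τ)).im := by
        rw [show -1 / (2 * τ) = ((3 / 2 : ℝ) : ℂ) * (-1 / (3 * τ)) by push_cast; field_simp,
          im_ofReal_mul]
      rw [this]
      positivity
    have h2 : 0 < (3 * τ / 2).im := by simpa using hτ
    have hs := ((summable_jacobiTheta₂_term_iff 0 _).mpr h2).norm.mul_of_nonneg
      ((summable_jacobiTheta₂_term_iff (u / (2 * τ)) _).mpr h1).norm
      (fun _ ↦ norm_nonneg _) fun _ ↦ norm_nonneg _
    refine Summable.mul_left _ (Summable.of_norm (hs.congr fun p ↦ ?_))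
    rw [norm_mul, mul_comm]
    congr 1
    rw [norm_jacobiTheta₂_term, norm_jacobiTheta₂_term]
    simp
  have hL : Summable (Function.uncurry L) := by
    refine Summable.of_norm ((summable_exp_of_quadratic_le (a := (u ^ 2 + v ^ 2) / 2)
      (r := fun p ↦ (p.1 - u : ℝ) ^ 2 - (p.1 - u) * (p.2 - v) + (p.2 - v : ℝ) ^ 2) hσ
        fun p ↦ ?_).congr fun p ↦ ?_)
    · nlinarith [sq_nonneg ((p.1 : ℝ) - 2 * u), sq_nonneg ((p.2 : ℝ) - 2 * v),
        sq_nonneg ((p.1 : ℝ) - u - (p.2 - v))]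
    · rw [← norm_cexp_two_pi_mul]
      simp [Function.uncurry, L]
  have hcol (n : ℤ) : ∑' m : ℤ, cexp (2 * Real.pi * I * (m * u + n * v)) *
        cexp (2 * Real.pi * I * ((m : ℂ) ^ 2 + m * n + (n : ℂ) ^ 2) * τ) =
      1 / (-I * (2 * τ)) ^ (1 / 2 : ℂ) * ∑' k, K n k := by
    have h1 : ∑' m : ℤ, cexp (2 * Real.pi * I * (m * u + n * v)) *
          cexp (2 * Real.pi * I * ((m : ℂ) ^ 2 + m * n + (n : ℂ) ^ 2) * τ) =
        cexp (2 * Real.pi * I * (n * v + n ^ 2 * τ)) * jacobiTheta₂ (u + n * τ) (2 * τ) := by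
      rw [jacobiTheta₂, ← tsum_mul_left]
      refine tsum_congr fun m ↦ ?_
      rw [jacobiTheta₂_term, ← exp_add, ← exp_add]
      congr 1
      ring
    rw [h1, jacobiTheta₂_functional_equation, jacobiTheta₂, mul_assoc (1 / _),
      mul_left_comm _ (1 / _)]
    congr 1
    rw [← tsum_mul_left, ← tsum_mul_left]
    refine tsum_congr fun k ↦ ?_
    simp only [K, jacobiTheta₂_term, ← exp_add]
    congr 1
    field_simp
    ring
  have hrow (k : ℤ) : ∑' n : ℤ, K n k = 1 / (-I * (3 * τ / 2)) ^ (1 / 2 : ℂ) * ∑' l, L k l := by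
    simp only [K]
    rw [tsum_mul_left, tsum_mul_left, ← jacobiTheta₂, jacobiTheta₂_functional_equation,
      jacobiTheta₂, mul_assoc (1 / _), mul_left_comm _ (1 / _), mul_left_comm _ (1 / _)]
    congr 1
    rw [← tsum_mul_left, ← tsum_mul_left, ← tsum_mul_left]
    refine tsum_congr fun l ↦ ?_
    simp only [L, jacobiTheta₂_term, ← exp_add]
    congr 1
    field_simp
    ring
  calc _ = ∑' n : ℤ, ∑' m : ℤ, cexp (2 * Real.pi * I * (m * u + n * v)) *
        cexp (2 * Real.pi * I * ((m : ℂ) ^ 2 + m * n + (n : ℂ) ^ 2) * τ) := by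
        rw [← (Equiv.prodComm ℤ ℤ).tsum_eq]
        exact ((Equiv.prodComm ℤ ℤ).summable_iff.mpr hF).tsum_prod
    _ = 1 / (-I * (2 * τ)) ^ (1 / 2 : ℂ) * ∑' k, ∑' n, K n k := by
        simp_rw [hcol]
        rw [tsum_mul_left, hK.tsum_comm]
    _ = 1 / (-I * (2 * τ)) ^ (1 / 2 : ℂ) * (1 / (-I * (3 * τ / 2)) ^ (1 / 2 : ℂ)) *
        ∑' k, ∑' l, L k l := by
        simp_rw [hrow]
        rw [tsum_mul_left, mul_assoc]
    _ = _ := by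
        rw [one_div_mul_one_div, cpow_half_mul_cpow_half hτ0, one_div,
          ← hL.tsum_prod_uncurry fun k ↦ hL.prod_factor k]
        rfl

theorem A3_neg_one_div_three_mul {τ : ℂ} (hτ : 0 < τ.im) :
    A3 (-1 / (3 * τ)) = -I * √3 * τ * A3 τ := by
  have hτ0 : τ ≠ 0 := fun h ↦ by simp [h] at hτ
  have h := tsum_hexagonal_inversion 0 0 hτ
  have hA : A3 τ = (-I * √3 * τ)⁻¹ * A3 (-1 / (3 * τ)) := by
    simp only [A3]
    convert h using 2
    · simp
    · rw [← ((Equiv.neg ℤ).prodCongr (Equiv.refl ℤ)).tsum_eq]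
      refine tsum_congr fun p ↦ ?_
      simp [sub_eq_add_neg]
  rw [hA, mul_inv_cancel_left₀]
  simp [hτ0]

theorem C3_neg_one_div_three_mul {τ : ℂ} (hτ : 0 < τ.im) :
    C3 (-1 / (3 * τ)) = -I * √3 * τ * B3 τ := by
  have hτ0 : τ ≠ 0 := fun h ↦ by simp [h] at hτ
  have hB : B3 τ = (-I * √3 * τ)⁻¹ * C3 (-1 / (3 * τ)) := by
    calc _ = _ := tsum_congr fun p ↦ ?_
      _ = _ := tsum_hexagonal_inversion (1 / 3) (-1 / 3) hτ
      _ = _ := congrArg _ ?_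
    · congr 2
      push_cast
      ring
    · rw [C3, ← ((Equiv.neg ℤ).prodCongr (Equiv.refl ℤ)).tsum_eq]
      refine tsum_congr fun p ↦ ?_
      congr 1
      simp only [Equiv.prodCongr_apply, Prod.map_fst, Prod.map_snd, Equiv.neg_apply,
        Equiv.refl_apply]
      push_cast
      ring
  rw [hB, mul_inv_cancel_left₀]
  simp [hτ0]

theorem B3_neg_one_div_three_mul {τ : ℂ} (hτ : 0 < τ.im) :
    B3 (-1 / (3 * τ)) = -I * √3 * τ * C3 τ := by
  have hτ0 : τ ≠ 0 := fun h ↦ by simp [h] at hτ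
  have h3 : (√3 : ℂ) ^ 2 = 3 := by
    norm_cast
    simp
  have h := C3_neg_one_div_three_mul (im_neg_one_div_three_mul_pos hτ)
  rw [show -1 / (3 * (-1 / (3 * τ))) = τ by field_simp] at h
  rw [h]
  generalize B3 (-1 / (3 * τ)) = b
  field_simp
  linear_combination b * I ^ 2 * h3 + 3 * b * I_sq

end

section

open Complex Filter Topology

lemma quadratic_lower_bound (p : ℤ × ℤ) :
    ((p.1 : ℝ) ^ 2 + (p.2 : ℝ) ^ 2) / 4 - 0 ≤ (p.1 : ℝ) ^ 2 + p.1 * p.2 + (p.2 : ℝ) ^ 2 := by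
  nlinarith [sq_nonneg ((p.1 : ℝ) + p.2), sq_nonneg (p.1 : ℝ), sq_nonneg (p.2 : ℝ)]

lemma shifted_quadratic_lower_bound (p : ℤ × ℤ) : ((p.1 : ℝ) ^ 2 + (p.2 : ℝ) ^ 2) / 4 - 1 ≤
    (p.1 : ℝ) ^ 2 + p.1 * p.2 + (p.2 : ℝ) ^ 2 + p.1 + p.2 + 1 / 3 := by
  nlinarith [sq_nonneg ((p.1 : ℝ) + p.2 + 1), sq_nonneg ((p.1 : ℝ) + 1), sq_nonneg ((p.2 : ℝ) + 1)]

lemma quadratic_nonneg (p : ℤ × ℤ) : 0 ≤ (p.1 : ℝ) ^ 2 + p.1 * p.2 + (p.2 : ℝ) ^ 2 := by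
  nlinarith [quadratic_lower_bound p, sq_nonneg (p.1 : ℝ), sq_nonneg (p.2 : ℝ)]

lemma shifted_quadratic_nonneg (p : ℤ × ℤ) :
    0 ≤ (p.1 : ℝ) ^ 2 + p.1 * p.2 + (p.2 : ℝ) ^ 2 + p.1 + p.2 + 1 / 3 := by
  nlinarith [sq_nonneg ((p.1 : ℝ) + p.2 / 2 + 1 / 2), sq_nonneg ((p.2 : ℝ) + 1 / 3)]

lemma quadratic_eq_zero_iff (p : ℤ × ℤ) :
    (p.1 : ℝ) ^ 2 + p.1 * p.2 + (p.2 : ℝ) ^ 2 = 0 ↔ p = 0 := by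
  refine ⟨fun h ↦ ?_, fun h ↦ by simp [h]⟩
  have h1 : (p.1 : ℝ) = 0 := by
    nlinarith [quadratic_lower_bound p, sq_nonneg (p.1 : ℝ), sq_nonneg (p.2 : ℝ)]
  have h2 : (p.2 : ℝ) = 0 := by
    nlinarith [quadratic_lower_bound p, sq_nonneg (p.1 : ℝ), sq_nonneg (p.2 : ℝ)]
  exact Prod.ext (by exact_mod_cast h1) (by exact_mod_cast h2)

lemma shifted_quadratic_ne_zero (p : ℤ × ℤ) :
    (p.1 : ℝ) ^ 2 + p.1 * p.2 + (p.2 : ℝ) ^ 2 + p.1 + p.2 + 1 / 3 ≠ 0 := by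
  intro h
  have h3 : 3 * (p.1 ^ 2 + p.1 * p.2 + p.2 ^ 2 + p.1 + p.2) + 1 = 0 := by
    have : (3 * (p.1 ^ 2 + p.1 * p.2 + p.2 ^ 2 + p.1 + p.2) + 1 : ℝ) = 0 := by linarith
    exact_mod_cast this
  lia

lemma norm_cexp_character (p : ℤ × ℤ) :
    ‖cexp (2 * Real.pi * I * ((p.1 : ℂ) - (p.2 : ℂ)) / 3)‖ = 1 := by
  rw [norm_exp]
  simp

lemma A3_eq_tsum : A3 = fun τ ↦ ∑' p : ℤ × ℤ, 1 * cexp (2 * Real.pi * I *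
    (((p.1 : ℝ) ^ 2 + p.1 * p.2 + (p.2 : ℝ) ^ 2 : ℝ) : ℂ) * τ) := by
  ext τ
  simp [A3]

lemma B3_eq_tsum : B3 = fun τ ↦ ∑' p : ℤ × ℤ,
    cexp (2 * Real.pi * I * ((p.1 : ℂ) - (p.2 : ℂ)) / 3) * cexp (2 * Real.pi * I *
      (((p.1 : ℝ) ^ 2 + p.1 * p.2 + (p.2 : ℝ) ^ 2 : ℝ) : ℂ) * τ) := by
  ext τ
  simp [B3]

lemma C3_eq_tsum : C3 = fun τ ↦ ∑' p : ℤ × ℤ, 1 * cexp (2 * Real.pi * I *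
    (((p.1 : ℝ) ^ 2 + p.1 * p.2 + (p.2 : ℝ) ^ 2 + p.1 + p.2 + 1 / 3 : ℝ) : ℂ) * τ) := by
  ext τ
  simp [C3]

lemma E2_eq_sub_tsum : E2 = fun τ ↦ 1 - 24 * ∑' n : ℕ, (∑ d ∈ Nat.divisors (n + 1), (d : ℂ)) *
    cexp (2 * Real.pi * I * ((n + 1 : ℝ) : ℂ) * τ) := by
  ext τ
  simp [E2]

lemma summable_A3_norm {ε : ℝ} (hε : 0 < ε) : Summable fun p : ℤ × ℤ ↦ ‖(1 : ℂ)‖ *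
    Real.exp (-2 * Real.pi * ((p.1 : ℝ) ^ 2 + p.1 * p.2 + (p.2 : ℝ) ^ 2) * ε) := by
  simpa using summable_exp_of_quadratic_le hε quadratic_lower_bound

lemma summable_B3_norm {ε : ℝ} (hε : 0 < ε) : Summable fun p : ℤ × ℤ ↦
    ‖cexp (2 * Real.pi * I * ((p.1 : ℂ) - (p.2 : ℂ)) / 3)‖ *
      Real.exp (-2 * Real.pi * ((p.1 : ℝ) ^ 2 + p.1 * p.2 + (p.2 : ℝ) ^ 2) * ε) := by
  simpa only [norm_cexp_character, one_mul]
    using summable_exp_of_quadratic_le hε quadratic_lower_bound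

lemma summable_C3_norm {ε : ℝ} (hε : 0 < ε) : Summable fun p : ℤ × ℤ ↦ ‖(1 : ℂ)‖ *
    Real.exp (-2 * Real.pi *
      ((p.1 : ℝ) ^ 2 + p.1 * p.2 + (p.2 : ℝ) ^ 2 + p.1 + p.2 + 1 / 3) * ε) := by
  simpa using summable_exp_of_quadratic_le hε shifted_quadratic_lower_bound

lemma norm_sum_divisors_le (n : ℕ) :
    ‖∑ d ∈ Nat.divisors (n + 1), (d : ℂ)‖ ≤ ((n + 1 : ℕ) : ℝ) ^ 2 := by
  refine (norm_sum_le_of_le (n := fun _ ↦ ((n + 1 : ℕ) : ℝ)) _ fun d hd ↦ ?_).trans ?_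
  · rw [norm_natCast]
    exact_mod_cast Nat.divisor_le hd
  · rw [Finset.sum_const, nsmul_eq_mul, sq]
    gcongr
    exact Nat.card_divisors_le_self _

lemma summable_E2_norm {ε : ℝ} (hε : 0 < ε) : Summable fun n : ℕ ↦
    ‖∑ d ∈ Nat.divisors (n + 1), (d : ℂ)‖ * Real.exp (-2 * Real.pi * (n + 1 : ℝ) * ε) := by
  have h := (summable_nat_add_iff 1).mpr
    (Real.summable_pow_mul_exp_neg_nat_mul 2 (mul_pos Real.two_pi_pos hε))
  refine h.of_nonneg_of_le (fun n ↦ by positivity) fun n ↦ ?_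
  refine mul_le_mul (norm_sum_divisors_le n) (le_of_eq ?_) (by positivity) (by positivity)
  congr 1
  push_cast
  ring

lemma differentiableOn_A3 : DifferentiableOn ℂ A3 {τ | 0 < τ.im} := by
  rw [A3_eq_tsum]
  exact differentiableOn_tsum_cexp quadratic_nonneg fun _ ↦ summable_A3_norm

lemma differentiableOn_B3 : DifferentiableOn ℂ B3 {τ | 0 < τ.im} := by
  rw [B3_eq_tsum]
  exact differentiableOn_tsum_cexp quadratic_nonneg fun _ ↦ summable_B3_norm

lemma differentiableOn_C3 : DifferentiableOn ℂ C3 {τ | 0 < τ.im} := by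
  rw [C3_eq_tsum]
  exact differentiableOn_tsum_cexp shifted_quadratic_nonneg fun _ ↦ summable_C3_norm

lemma differentiableOn_E2 : DifferentiableOn ℂ E2 {τ | 0 < τ.im} := by
  rw [E2_eq_sub_tsum]
  exact ((differentiableOn_tsum_cexp (fun n : ℕ ↦ by positivity)
    fun _ ↦ summable_E2_norm).const_mul 24).const_sub 1

lemma differentiableOn_E3quasi : DifferentiableOn ℂ E3quasi {τ | 0 < τ.im} := by
  have h : DifferentiableOn ℂ (fun τ ↦ E2 (3 * τ)) {τ | 0 < τ.im} :=
    differentiableOn_E2.comp (differentiableOn_id.const_mul 3) fun τ hτ ↦ by simpa using hτ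
  exact ((h.const_mul 3).add differentiableOn_E2).div_const 4

lemma tendsto_A3 : Tendsto A3 (comap im atTop) (𝓝 1) := by
  rw [A3_eq_tsum]
  convert tendsto_tsum_cexp (c := fun _ : ℤ × ℤ ↦ (1 : ℂ)) quadratic_nonneg
    fun _ ↦ summable_A3_norm using 2
  simp [quadratic_eq_zero_iff]

lemma tendsto_B3 : Tendsto B3 (comap im atTop) (𝓝 1) := by
  rw [B3_eq_tsum]
  convert tendsto_tsum_cexp quadratic_nonneg fun _ ↦ summable_B3_norm using 2
  simp [quadratic_eq_zero_iff]

lemma tendsto_C3 : Tendsto C3 (comap im atTop) (𝓝 0) := by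
  rw [C3_eq_tsum]
  convert tendsto_tsum_cexp (c := fun _ : ℤ × ℤ ↦ (1 : ℂ)) shifted_quadratic_nonneg
    fun _ ↦ summable_C3_norm using 2
  simp only [if_neg (shifted_quadratic_ne_zero _), tsum_zero]

lemma tendsto_E2 : Tendsto E2 (comap im atTop) (𝓝 1) := by
  rw [E2_eq_sub_tsum]
  have h := tendsto_tsum_cexp (fun n : ℕ ↦ by positivity) fun _ ↦ summable_E2_norm
  have h0 (n : ℕ) : (n + 1 : ℝ) ≠ 0 := by positivity
  simp only [if_neg (h0 _), tsum_zero] at h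
  simpa using (h.const_mul 24).const_sub 1

lemma tendsto_E3quasi : Tendsto E3quasi (comap im atTop) (𝓝 1) := by
  have h : Tendsto (fun τ ↦ E2 (3 * τ)) (comap im atTop) (𝓝 1) := by
    refine tendsto_E2.comp (tendsto_comap_iff.mpr ?_)
    refine (tendsto_comap.const_mul_atTop (by norm_num : (0 : ℝ) < 3)).congr fun τ ↦ ?_
    simp
  convert ((h.const_mul 3).add tendsto_E2).div_const 4 using 2
  · exact E3quasi.eq_1 _
  · norm_num

lemma A3_add_one (τ : ℂ) : A3 (τ + 1) = A3 τ := by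
  refine tsum_congr fun p ↦ ?_
  rw [← exp_periodic.int_mul (p.1 ^ 2 + p.1 * p.2 + p.2 ^ 2)
    (2 * Real.pi * I * ((p.1 : ℂ) ^ 2 + p.1 * p.2 + (p.2 : ℂ) ^ 2) * τ)]
  congr 1
  push_cast
  ring

lemma B3_add_one (τ : ℂ) : B3 (τ + 1) = B3 τ := by
  refine tsum_congr fun p ↦ ?_
  rw [← exp_periodic.int_mul (p.1 ^ 2 + p.1 * p.2 + p.2 ^ 2)
    (2 * Real.pi * I * ((p.1 : ℂ) ^ 2 + p.1 * p.2 + (p.2 : ℂ) ^ 2) * τ)]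
  congr 2
  push_cast
  ring

lemma C3_add_one (τ : ℂ) : C3 (τ + 1) = cexp (2 * Real.pi * I / 3) * C3 τ := by
  rw [C3, C3, ← tsum_mul_left]
  refine tsum_congr fun p ↦ ?_
  rw [← exp_add, ← exp_periodic.int_mul (p.1 ^ 2 + p.1 * p.2 + p.2 ^ 2 + p.1 + p.2)
    (2 * Real.pi * I / 3 + _)]
  congr 1
  push_cast
  ring

lemma E2_add_one (τ : ℂ) : E2 (τ + 1) = E2 τ := by
  rw [E2, E2]
  congr 2
  refine tsum_congr fun n ↦ ?_
  rw [← exp_periodic.nat_mul (n + 1) (2 * Real.pi * I * ((n : ℂ) + 1) * τ)]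
  congr 2
  push_cast
  ring

lemma E3quasi_add_one (τ : ℂ) : E3quasi (τ + 1) = E3quasi τ := by
  rw [E3quasi, E3quasi, E2_add_one, show 3 * (τ + 1) = 3 * τ + 1 + 1 + 1 by ring, E2_add_one,
    E2_add_one, E2_add_one]

lemma E2_eq_eisensteinSeries (z : UpperHalfPlane) : E2 z = EisensteinSeries.E2 z := by
  rw [EisensteinSeries.E2_eq_tsum_cexp, tsum_pnat_eq_tsum_succ
    (f := fun n ↦ (ArithmeticFunction.sigma 1 n : ℂ) * cexp (2 * Real.pi * I * z) ^ n), E2]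
  congr 2
  refine tsum_congr fun n ↦ ?_
  rw [ArithmeticFunction.sigma_one_apply, ← exp_nat_mul]
  push_cast
  congr 2
  ring

lemma E2_neg_one_div {τ : ℂ} (hτ : 0 < τ.im) :
    E2 (-1 / τ) = τ ^ 2 * E2 τ + 6 * τ / (Real.pi * I) := by
  lift τ to UpperHalfPlane using hτ
  have h := congrFun (EisensteinSeries.E2_slash_action ModularGroup.S) τ
  rw [ModularForm.SL_slash_apply] at h
  simp only [UpperHalfPlane.modular_S_smul, ModularGroup.denom_S, Pi.sub_apply, Pi.smul_apply,
    EisensteinSeries.D2_S, ← E2_eq_eisensteinSeries, riemannZeta_two, smul_eq_mul] at h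
  have hτ0 := UpperHalfPlane.ne_zero τ
  have hπ : (Real.pi : ℂ) ≠ 0 := ofReal_ne_zero.mpr Real.pi_ne_zero
  rw [show (-(τ : ℂ))⁻¹ = -1 / τ by rw [inv_neg, neg_div, one_div]] at h
  generalize E2 (-1 / τ) = a at h ⊢
  generalize E2 τ = b at h ⊢
  have h' : a = τ ^ 2 * (a * (τ : ℂ) ^ (-2 : ℤ)) := by
    field_simp
  rw [h', h]
  field_simp
  linear_combination (-6) * I_sq

lemma E3quasi_neg_one_div_three_mul {τ : ℂ} (hτ : 0 < τ.im) :
    E3quasi (-1 / (3 * τ)) = 3 * τ ^ 2 * E3quasi τ + 9 * τ / (Real.pi * I) := by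
  have hτ0 : τ ≠ 0 := fun h ↦ by simp [h] at hτ
  have h3 : 0 < (3 * τ).im := by simpa using hτ
  rw [E3quasi, E3quasi, show 3 * (-1 / (3 * τ)) = -1 / τ by field_simp, E2_neg_one_div hτ,
    E2_neg_one_div h3]
  ring

end

section

open Complex Filter Topology Asymptotics

/-- Defect of the differential equation for `A3`. -/
noncomputable def defectA (τ : ℂ) : ℂ :=
  6 * (1 / (2 * Real.pi * I) * deriv A3 τ) - (A3 τ * E3quasi τ + C3 τ ^ 3 - B3 τ ^ 3)

/-- Defect of the differential equation for `B3`. -/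
noncomputable def defectB (τ : ℂ) : ℂ :=
  6 * (1 / (2 * Real.pi * I) * deriv B3 τ) - B3 τ * (E3quasi τ - A3 τ ^ 2)

/-- Defect of the differential equation for `C3`. -/
noncomputable def defectC (τ : ℂ) : ℂ :=
  6 * (1 / (2 * Real.pi * I) * deriv C3 τ) - C3 τ * (E3quasi τ + A3 τ ^ 2)

/-- Defect of the differential equation for `E3quasi`. -/
noncomputable def defectE (τ : ℂ) : ℂ :=
  6 * (1 / (2 * Real.pi * I) * deriv E3quasi τ) - (E3quasi τ ^ 2 - A3 τ ^ 4)

section Regularity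

lemma isOpen_setOf_im_pos : IsOpen {τ : ℂ | 0 < τ.im} := isOpen_lt continuous_const continuous_im

lemma differentiableOn_defectA : DifferentiableOn ℂ defectA {τ | 0 < τ.im} :=
  (((differentiableOn_A3.deriv isOpen_setOf_im_pos).const_mul _).const_mul _).sub
    (((differentiableOn_A3.mul differentiableOn_E3quasi).add (differentiableOn_C3.pow 3)).sub
      (differentiableOn_B3.pow 3))

lemma differentiableOn_defectB : DifferentiableOn ℂ defectB {τ | 0 < τ.im} :=
  (((differentiableOn_B3.deriv isOpen_setOf_im_pos).const_mul _).const_mul _).sub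
    (differentiableOn_B3.mul (differentiableOn_E3quasi.sub (differentiableOn_A3.pow 2)))

lemma differentiableOn_defectC : DifferentiableOn ℂ defectC {τ | 0 < τ.im} :=
  (((differentiableOn_C3.deriv isOpen_setOf_im_pos).const_mul _).const_mul _).sub
    (differentiableOn_C3.mul (differentiableOn_E3quasi.add (differentiableOn_A3.pow 2)))

lemma differentiableOn_defectE : DifferentiableOn ℂ defectE {τ | 0 < τ.im} :=
  (((differentiableOn_E3quasi.deriv isOpen_setOf_im_pos).const_mul _).const_mul _).sub
    ((differentiableOn_E3quasi.pow 2).sub (differentiableOn_A3.pow 4))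

end Regularity

section Periodicity

lemma deriv_add_one_of_forall_eq {f : ℂ → ℂ} {c : ℂ} (hf : ∀ τ, f (τ + 1) = c * f τ) (τ : ℂ) :
    deriv f (τ + 1) = c * deriv f τ := by
  rw [← deriv_comp_add_const, funext hf, deriv_const_mul_field]

lemma deriv_add_one_of_periodic {f : ℂ → ℂ} (hf : ∀ τ, f (τ + 1) = f τ) (τ : ℂ) :
    deriv f (τ + 1) = deriv f τ := by
  simpa using deriv_add_one_of_forall_eq (c := 1) (by simpa using hf) τ

lemma cexp_two_pi_mul_I_div_three_pow : cexp (2 * Real.pi * I / 3) ^ 3 = 1 := by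
  rw [← exp_nat_mul, ← exp_two_pi_mul_I]
  congr 1
  push_cast
  ring

lemma defectA_add_one (τ : ℂ) : defectA (τ + 1) = defectA τ := by
  simp only [defectA, deriv_add_one_of_periodic A3_add_one, A3_add_one, B3_add_one, C3_add_one,
    E3quasi_add_one, mul_pow, cexp_two_pi_mul_I_div_three_pow, one_mul]

lemma defectB_add_one (τ : ℂ) : defectB (τ + 1) = defectB τ := by
  simp only [defectB, deriv_add_one_of_periodic B3_add_one, A3_add_one, B3_add_one,
    E3quasi_add_one]

lemma defectC_add_one (τ : ℂ) : defectC (τ + 1) = cexp (2 * Real.pi * I / 3) * defectC τ := by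
  simp only [defectC, deriv_add_one_of_forall_eq C3_add_one, A3_add_one, C3_add_one,
    E3quasi_add_one]
  ring

lemma defectE_add_one (τ : ℂ) : defectE (τ + 1) = defectE τ := by
  simp only [defectE, deriv_add_one_of_periodic E3quasi_add_one, A3_add_one, E3quasi_add_one]

end Periodicity

section Decay

lemma tendsto_defectA : Tendsto defectA (comap im atTop) (𝓝 0) := by
  have hd := tendsto_deriv_comap_im_atTop differentiableOn_A3 tendsto_A3
  convert ((hd.const_mul (1 / (2 * Real.pi * I))).const_mul 6).sub
    (((tendsto_A3.mul tendsto_E3quasi).add (tendsto_C3.pow 3)).sub (tendsto_B3.pow 3)) using 2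
  · exact defectA.eq_1 _
  · norm_num

lemma tendsto_defectB : Tendsto defectB (comap im atTop) (𝓝 0) := by
  have hd := tendsto_deriv_comap_im_atTop differentiableOn_B3 tendsto_B3
  convert ((hd.const_mul (1 / (2 * Real.pi * I))).const_mul 6).sub
    (tendsto_B3.mul (tendsto_E3quasi.sub (tendsto_A3.pow 2))) using 2
  · exact defectB.eq_1 _
  · norm_num

lemma tendsto_defectC : Tendsto defectC (comap im atTop) (𝓝 0) := by
  have hd := tendsto_deriv_comap_im_atTop differentiableOn_C3 tendsto_C3
  convert ((hd.const_mul (1 / (2 * Real.pi * I))).const_mul 6).sub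
    (tendsto_C3.mul (tendsto_E3quasi.add (tendsto_A3.pow 2))) using 2
  · exact defectC.eq_1 _
  · norm_num

lemma tendsto_defectE : Tendsto defectE (comap im atTop) (𝓝 0) := by
  have hd := tendsto_deriv_comap_im_atTop differentiableOn_E3quasi tendsto_E3quasi
  convert ((hd.const_mul (1 / (2 * Real.pi * I))).const_mul 6).sub
    ((tendsto_E3quasi.pow 2).sub (tendsto_A3.pow 4)) using 2
  · exact defectE.eq_1 _
  · norm_num

lemma isBigO_exp_of_periodic {f : ℂ → ℂ} (hd : DifferentiableOn ℂ f {τ | 0 < τ.im})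
    (hf : ∀ τ, f (τ + 1) = f τ) (h0 : Tendsto f (comap im atTop) (𝓝 0)) :
    f =O[comap im atTop] fun τ ↦ Real.exp (-2 * Real.pi * τ.im) := by
  have h := Function.Periodic.exp_decay_of_zero_at_inf (h := 1) one_pos (by simpa using hf)
    ((tendsto_comap.eventually (eventually_gt_atTop 0)).mono fun τ hτ ↦
      hd.differentiableAt (isOpen_setOf_im_pos.mem_nhds hτ)) h0
  simpa using h

lemma isLittleO_pow_of_isBigO_exp {f : ℂ → ℂ} {m n : ℕ} (hmn : 2 * m < n)
    (hf : f =O[comap im atTop] fun τ ↦ Real.exp (-2 * Real.pi * τ.im)) :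
    (fun τ ↦ f τ ^ n) =o[comap im atTop] fun τ ↦ Real.exp (-4 * Real.pi * m * τ.im) := by
  refine (hf.pow n).trans_isLittleO ?_
  have h : (fun y : ℝ ↦ Real.exp (-2 * Real.pi * y) ^ n) =o[atTop]
      fun y ↦ Real.exp (-4 * Real.pi * m * y) := by
    simp_rw [← Real.exp_nat_mul]
    rw [Real.isLittleO_exp_comp_exp_comp]
    have hc : (0 : ℝ) < 2 * Real.pi * (n - 2 * m) :=
      mul_pos Real.two_pi_pos (sub_pos.mpr (by exact_mod_cast hmn))
    refine (tendsto_id.const_mul_atTop hc).congr fun y ↦ ?_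
    simp only [id]
    ring
  exact h.comp_tendsto tendsto_comap

end Decay

section Fricke

lemma deriv_neg_one_div_three_mul {F g : ℂ → ℂ} {τ g' : ℂ} (hτ : 0 < τ.im)
    (hF : DifferentiableOn ℂ F {τ | 0 < τ.im})
    (h : ∀ τ : ℂ, 0 < τ.im → F (-1 / (3 * τ)) = g τ) (hg : HasDerivAt g g' τ) :
    deriv F (-1 / (3 * τ)) = 3 * τ ^ 2 * g' := by
  have hτ0 : τ ≠ 0 := fun h ↦ by simp [h] at hτ
  have hF' := (hF.differentiableAt
    (isOpen_setOf_im_pos.mem_nhds (im_neg_one_div_three_mul_pos hτ))).hasDerivAt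
  have hW : HasDerivAt (fun z : ℂ ↦ -1 / (3 * z)) (1 / (3 * τ ^ 2)) τ := by
    refine ((hasDerivAt_const τ (-1 : ℂ)).div ((hasDerivAt_id τ).const_mul 3)
      (mul_ne_zero three_ne_zero hτ0)).congr_deriv ?_
    simp only [id]
    field_simp
    ring
  have hg' : HasDerivAt g (deriv F (-1 / (3 * τ)) * (1 / (3 * τ ^ 2))) τ :=
    (hF'.comp τ hW).congr_of_eventuallyEq
      (mem_of_superset (isOpen_setOf_im_pos.mem_nhds hτ) fun z hz ↦ (h z hz).symm)
  rw [hg.unique hg']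
  field_simp

lemma deriv_neg_one_div_three_mul_of_weight_one {F G : ℂ → ℂ} {τ : ℂ} (hτ : 0 < τ.im)
    (hF : DifferentiableOn ℂ F {τ | 0 < τ.im}) (hG : DifferentiableOn ℂ G {τ | 0 < τ.im})
    (h : ∀ τ : ℂ, 0 < τ.im → F (-1 / (3 * τ)) = -I * √3 * τ * G τ) :
    deriv F (-1 / (3 * τ)) = 3 * τ ^ 2 * (-I * √3 * (G τ + τ * deriv G τ)) := by
  have hG' := (hG.differentiableAt (isOpen_setOf_im_pos.mem_nhds hτ)).hasDerivAt
  refine deriv_neg_one_div_three_mul hτ hF h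
    ((((hasDerivAt_id τ).const_mul (-I * √3)).mul hG').congr_deriv ?_)
  simp only [id]
  ring

lemma deriv_E3quasi_neg_one_div_three_mul {τ : ℂ} (hτ : 0 < τ.im) :
    deriv E3quasi (-1 / (3 * τ)) = 3 * τ ^ 2 *
      (6 * τ * E3quasi τ + 3 * τ ^ 2 * deriv E3quasi τ + 9 / (Real.pi * I)) := by
  have hE' := (differentiableOn_E3quasi.differentiableAt
    (isOpen_setOf_im_pos.mem_nhds hτ)).hasDerivAt
  refine deriv_neg_one_div_three_mul hτ differentiableOn_E3quasi
    (fun _ ↦ E3quasi_neg_one_div_three_mul)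
    ((((((hasDerivAt_id τ).pow 2).const_mul 3).mul hE').add
      (((hasDerivAt_id τ).const_mul 9).div_const (Real.pi * I))).congr_deriv ?_)
  simp only [id, Pi.pow_apply]
  push_cast
  ring

lemma sqrt_three_sq : (√3 : ℂ) ^ 2 = 3 := by
  norm_cast
  simp

lemma neg_I_mul_sqrt_three_mul_sq (τ : ℂ) : (-I * √3 * τ) ^ 2 = -3 * τ ^ 2 := by
  rw [mul_pow, mul_pow, sqrt_three_sq, neg_sq, I_sq]
  ring

lemma defectA_neg_one_div_three_mul {τ : ℂ} (hτ : 0 < τ.im) :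
    defectA (-1 / (3 * τ)) = 3 * τ ^ 2 * (-I * √3 * τ) * defectA τ := by
  rw [defectA, defectA, deriv_neg_one_div_three_mul_of_weight_one hτ differentiableOn_A3
    differentiableOn_A3 fun _ ↦ A3_neg_one_div_three_mul, A3_neg_one_div_three_mul hτ,
    B3_neg_one_div_three_mul hτ, C3_neg_one_div_three_mul hτ, E3quasi_neg_one_div_three_mul hτ]
  linear_combination (-I * √3 * τ) * (C3 τ ^ 3 - B3 τ ^ 3) * neg_I_mul_sqrt_three_mul_sq τ

lemma defectB_neg_one_div_three_mul {τ : ℂ} (hτ : 0 < τ.im) :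
    defectB (-1 / (3 * τ)) = 3 * τ ^ 2 * (-I * √3 * τ) * defectC τ := by
  rw [defectB, defectC, deriv_neg_one_div_three_mul_of_weight_one hτ differentiableOn_B3
    differentiableOn_C3 fun _ ↦ B3_neg_one_div_three_mul, A3_neg_one_div_three_mul hτ,
    B3_neg_one_div_three_mul hτ, E3quasi_neg_one_div_three_mul hτ]
  linear_combination (-I * √3 * τ) * C3 τ * A3 τ ^ 2 * neg_I_mul_sqrt_three_mul_sq τ

lemma defectC_neg_one_div_three_mul {τ : ℂ} (hτ : 0 < τ.im) :
    defectC (-1 / (3 * τ)) = 3 * τ ^ 2 * (-I * √3 * τ) * defectB τ := by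
  rw [defectC, defectB, deriv_neg_one_div_three_mul_of_weight_one hτ differentiableOn_C3
    differentiableOn_B3 fun _ ↦ C3_neg_one_div_three_mul, A3_neg_one_div_three_mul hτ,
    C3_neg_one_div_three_mul hτ, E3quasi_neg_one_div_three_mul hτ]
  linear_combination -(-I * √3 * τ) * B3 τ * A3 τ ^ 2 * neg_I_mul_sqrt_three_mul_sq τ

lemma defectE_neg_one_div_three_mul {τ : ℂ} (hτ : 0 < τ.im) :
    defectE (-1 / (3 * τ)) = 9 * τ ^ 4 * defectE τ := by
  rw [defectE, defectE, deriv_E3quasi_neg_one_div_three_mul hτ, A3_neg_one_div_three_mul hτ,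
    E3quasi_neg_one_div_three_mul hτ]
  linear_combination A3 τ ^ 4 * ((-I * √3 * τ) ^ 2 - 3 * τ ^ 2) * neg_I_mul_sqrt_three_mul_sq τ

end Fricke

section Vanishing

lemma defectA_eq_zero {τ : ℂ} (hτ : 0 < τ.im) : defectA τ = 0 := by
  refine pow_eq_zero_iff four_ne_zero |>.mp (eq_zero_of_fricke (m := 1)
    (differentiableOn_defectA.pow 4) (fun τ _ ↦ ?_) (fun τ hτ ↦ ?_)
    (isLittleO_pow_of_isBigO_exp (by norm_num)
      (isBigO_exp_of_periodic differentiableOn_defectA defectA_add_one tendsto_defectA)) τ hτ)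
  · simp only [Pi.pow_apply, defectA_add_one]
  · simp only [Pi.pow_apply, defectA_neg_one_div_three_mul hτ]
    linear_combination 81 * τ ^ 8 * defectA τ ^ 4 * ((-I * √3 * τ) ^ 2 - 3 * τ ^ 2) *
      neg_I_mul_sqrt_three_mul_sq τ

lemma defectE_eq_zero {τ : ℂ} (hτ : 0 < τ.im) : defectE τ = 0 := by
  refine pow_eq_zero_iff three_ne_zero |>.mp (eq_zero_of_fricke (m := 1)
    (differentiableOn_defectE.pow 3) (fun τ _ ↦ ?_) (fun τ hτ ↦ ?_)
    (isLittleO_pow_of_isBigO_exp (by norm_num)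
      (isBigO_exp_of_periodic differentiableOn_defectE defectE_add_one tendsto_defectE)) τ hτ)
  · simp only [Pi.pow_apply, defectE_add_one]
  · simp only [Pi.pow_apply, defectE_neg_one_div_three_mul hτ]
    ring

lemma defectB_mul_defectC_eq_zero {τ : ℂ} (hτ : 0 < τ.im) : defectB τ * defectC τ = 0 := by
  have hC : (fun τ ↦ (defectC τ ^ 3) ^ 2) =O[comap im atTop]
      fun τ ↦ Real.exp (-2 * Real.pi * τ.im) ^ 2 := by
    refine (isBigO_exp_of_periodic (differentiableOn_defectC.pow 3) (fun τ ↦ ?_) ?_).pow 2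
    · simp only [Pi.pow_apply, defectC_add_one, mul_pow, cexp_two_pi_mul_I_div_three_pow, one_mul]
    · rw [show defectC ^ 3 = fun τ ↦ defectC τ ^ 3 from rfl]
      simpa using tendsto_defectC.pow 3
  have hB := isLittleO_pow_of_isBigO_exp (m := 2) (n := 6) (by norm_num)
    (isBigO_exp_of_periodic differentiableOn_defectB defectB_add_one tendsto_defectB)
  refine pow_eq_zero_iff (n := 6) (by norm_num) |>.mp (eq_zero_of_fricke (m := 3)
    ((differentiableOn_defectB.mul differentiableOn_defectC).pow 6) (fun τ _ ↦ ?_)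
    (fun τ hτ ↦ ?_) ((hB.mul_isBigO hC).congr (fun τ ↦ ?_) fun τ ↦ ?_) τ hτ)
  · simp only [Pi.pow_apply, Pi.mul_apply, defectB_add_one, defectC_add_one]
    linear_combination defectB τ ^ 6 * defectC τ ^ 6 *
      (cexp (2 * Real.pi * I / 3) ^ 3 + 1) * cexp_two_pi_mul_I_div_three_pow
  · simp only [Pi.pow_apply, Pi.mul_apply, defectB_neg_one_div_three_mul hτ,
      defectC_neg_one_div_three_mul hτ]
    calc _ = 3 ^ 12 * τ ^ 24 * ((-I * √3 * τ) ^ 2) ^ 6 * (defectB τ * defectC τ) ^ 6 := by ring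
      _ = _ := by
        rw [neg_I_mul_sqrt_three_mul_sq]
        ring
  · simp only [Pi.pow_apply, Pi.mul_apply]
    ring
  · rw [← Real.exp_nat_mul, ← Real.exp_add]
    congr 1
    push_cast
    ring

lemma defectB_eq_zero_and_defectC_eq_zero {τ : ℂ} (hτ : 0 < τ.im) :
    defectB τ = 0 ∧ defectC τ = 0 := by
  have hW := im_neg_one_div_three_mul_pos hτ
  have hτ0 : τ ≠ 0 := fun h ↦ by simp [h] at hτ
  have hc : 3 * τ ^ 2 * (-I * √3 * τ) ≠ 0 := by simp [hτ0]
  rcases eq_zero_or_eq_zero_of_mul_eq_zero differentiableOn_defectB differentiableOn_defectC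
    fun _ ↦ defectB_mul_defectC_eq_zero with h | h
  · refine ⟨h τ hτ, ?_⟩
    have := defectB_neg_one_div_three_mul hτ
    rw [h _ hW] at this
    exact (mul_eq_zero.mp this.symm).resolve_left hc
  · refine ⟨?_, h τ hτ⟩
    have := defectC_neg_one_div_three_mul hτ
    rw [h _ hW] at this
    exact (mul_eq_zero.mp this.symm).resolve_left hc

end Vanishing

end

end RamanujanGamma0Three

theorem ramanujan_identities_Gamma0_three (τ : ℂ) (hτ : 0 < τ.im) :
    (1 / (2 * Real.pi * Complex.I)) * deriv A3 τ =
      (1 / 6) * (A3 τ * E3quasi τ + C3 τ ^ 3 - B3 τ ^ 3) ∧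
    (1 / (2 * Real.pi * Complex.I)) * deriv B3 τ =
      (1 / 6) * B3 τ * (E3quasi τ - A3 τ ^ 2) ∧
    (1 / (2 * Real.pi * Complex.I)) * deriv C3 τ =
      (1 / 6) * C3 τ * (E3quasi τ + A3 τ ^ 2) ∧
    (1 / (2 * Real.pi * Complex.I)) * deriv E3quasi τ =
      (1 / 6) * (E3quasi τ ^ 2 - A3 τ ^ 4) := by
  have hA := RamanujanGamma0Three.defectA_eq_zero hτ
  obtain ⟨hB, hC⟩ := RamanujanGamma0Three.defectB_eq_zero_and_defectC_eq_zero hτ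
  have hE := RamanujanGamma0Three.defectE_eq_zero hτ
  rw [RamanujanGamma0Three.defectA] at hA
  rw [RamanujanGamma0Three.defectB] at hB
  rw [RamanujanGamma0Three.defectC] at hC
  rw [RamanujanGamma0Three.defectE] at hE
  refine ⟨?_, ?_, ?_, ?_⟩
  · linear_combination hA / 6
  · linear_combination hB / 6
  · linear_combination hC / 6
  · linear_combination hE / 6
end

section
/- Ramanujan identities for Γ₀(4): set A(τ) = θ₃(2τ)², B(τ) = θ₄(2τ)², C(τ) = θ₂(2τ)², and E(τ) = (E₂(τ) − 2E₂(2τ) + 4E₂(4τ))/3. Then for every τ in the complex upper half-plane, (1/2πi)·dA/dτ = (1/4)·A(τ)·(E(τ) + C(τ)² − B(τ)²), (1/2πi)·dB/dτ = (1/4)·B(τ)·(E(τ) − A(τ)²), (1/2πi)·dC/dτ = (1/4)·C(τ)·(E(τ) + A(τ)²), and (1/2πi)·dE/dτ = (1/4)(E(τ)² − A(τ)⁴). -/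
noncomputable def theta2 (τ : ℂ) : ℂ :=
  ∑' n : ℤ, Complex.exp (Real.pi * Complex.I * ((n : ℂ) + 1/2)^2 * τ)

noncomputable def theta3 (τ : ℂ) : ℂ :=
  ∑' n : ℤ, Complex.exp (Real.pi * Complex.I * (n : ℂ)^2 * τ)

noncomputable def theta4 (τ : ℂ) : ℂ :=
  ∑' n : ℤ, (-1 : ℂ)^n * Complex.exp (Real.pi * Complex.I * (n : ℂ)^2 * τ)
noncomputable def A4form (τ : ℂ) : ℂ := theta3 (2 * τ) ^ 2

noncomputable def B4form (τ : ℂ) : ℂ := theta4 (2 * τ) ^ 2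

noncomputable def C4form (τ : ℂ) : ℂ := theta2 (2 * τ) ^ 2

noncomputable def E4quasi (τ : ℂ) : ℂ := (E2 τ - 2 * E2 (2 * τ) + 4 * E2 (4 * τ)) / 3

section LevelOne

open UpperHalfPlane hiding I
open ModularForm ModularGroup Complex Filter Topology MatrixGroups

/-- A holomorphic function on the upper half-plane with the transformation behaviour of a level one
modular form of weight `k`, vanishing at `i∞`, is (the restriction of) a cusp form. -/
lemma exists_cuspForm_of_transform {f : ℂ → ℂ} {k : ℕ}
    (hd : DifferentiableOn ℂ f {z | 0 < z.im})
    (hT : ∀ t : ℂ, 0 < t.im → f (t + 1) = f t)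
    (hS : ∀ t : ℂ, 0 < t.im → f (-1 / t) = t ^ k * f t)
    (h0 : Tendsto f (comap im atTop) (𝓝 0)) :
    ∃ g : CuspForm 𝒮ℒ k, ∀ z : ℍ, g z = f z := by
  have hsS : (fun z : ℍ ↦ f z) ∣[(k : ℤ)] S = fun z : ℍ ↦ f z := by
    ext z
    have hz : (z : ℂ) ≠ 0 := z.ne_zero
    have h := hS z z.im_pos
    rw [SL_slash_apply, modular_S_smul]
    simp only [denom_S]
    rw [show (-(z : ℂ))⁻¹ = -1 / z by rw [neg_div, one_div, inv_neg], h]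
    simp
    field_simp
  have hsT : (fun z : ℍ ↦ f z) ∣[(k : ℤ)] T = fun z : ℍ ↦ f z := by
    ext z
    have h := hT z z.im_pos
    rw [SL_slash_apply, modular_T_smul, ModularGroup.denom_apply]
    simp [T, add_comm (1 : ℂ), h]
  refine ⟨{ toFun := fun z ↦ f z
            slash_action_eq' := ?_
            holo' := ?_
            zero_at_cusps' := ?_ }, fun _ ↦ rfl⟩
  · rintro A ⟨A, rfl⟩
    exact SlashInvariantForm.slash_action_generators_SL2Z hsS hsT A
  · refine UpperHalfPlane.mdifferentiable_iff.mpr (hd.congr fun z hz ↦ ?_)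
    simp [ofComplex_apply_of_im_pos hz]
  · intro c hc
    rw [Subgroup.IsArithmetic.isCusp_iff_isCusp_SL2Z] at hc
    rw [OnePoint.isZeroAt_iff_forall_SL2Z hc]
    intro γ _
    have h := SlashInvariantForm.slash_action_generators_SL2Z hsS hsT γ
    refine (congrArg IsZeroAtImInfty h).mpr (h0.comp ?_)
    exact tendsto_comap_iff.mpr tendsto_comap

/-- There are no nonzero level one cusp forms of weight less than twelve. -/
lemma eq_zero_of_transform {f : ℂ → ℂ} {k : ℕ} (hk : k < 12)
    (hd : DifferentiableOn ℂ f {z | 0 < z.im})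
    (hT : ∀ t : ℂ, 0 < t.im → f (t + 1) = f t)
    (hS : ∀ t : ℂ, 0 < t.im → f (-1 / t) = t ^ k * f t)
    (h0 : Tendsto f (comap im atTop) (𝓝 0)) {t : ℂ} (ht : 0 < t.im) : f t = 0 := by
  obtain ⟨g, hg⟩ := exists_cuspForm_of_transform hd hT hS h0
  have h := rank_zero_iff_forall_zero.mp
    (CuspForm.rank_eq_zero_of_weight_lt_twelve (k := (k : ℤ)) (by exact_mod_cast hk)) g
  rw [← UpperHalfPlane.coe_mk t ht, ← hg, h]
  rfl

/-- A level one cusp form of weight twelve has no zeros unless it vanishes identically. -/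
lemma ne_zero_of_transform_twelve {f : ℂ → ℂ}
    (hd : DifferentiableOn ℂ f {z | 0 < z.im})
    (hT : ∀ t : ℂ, 0 < t.im → f (t + 1) = f t)
    (hS : ∀ t : ℂ, 0 < t.im → f (-1 / t) = t ^ 12 * f t)
    (h0 : Tendsto f (comap im atTop) (𝓝 0)) (hf : ∃ s : ℂ, 0 < s.im ∧ f s ≠ 0)
    {t : ℂ} (ht : 0 < t.im) : f t ≠ 0 := by
  obtain ⟨g, hg⟩ := exists_cuspForm_of_transform hd hT hS h0
  obtain ⟨c, hc⟩ := CuspForm.exists_smul_discriminant_of_weight_eq_twelve g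
  have key (z : ℍ) : f z = c * ModularForm.discriminant z := by
    rw [← hg, ← hc]
    rfl
  obtain ⟨s, hs, hfs⟩ := hf
  rw [← UpperHalfPlane.coe_mk t ht, key]
  refine mul_ne_zero (fun h ↦ hfs ?_) (discriminant_ne_zero _)
  rw [← UpperHalfPlane.coe_mk s hs, key, h, zero_mul]

/-- Three holomorphic functions permuted by the weight two action of the generators of the modular
group, all vanishing at `i∞`, are zero. -/
lemma eq_zero_of_permuted {x y z : ℂ → ℂ}
    (hx : DifferentiableOn ℂ x {z | 0 < z.im}) (hy : DifferentiableOn ℂ y {z | 0 < z.im})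
    (hz : DifferentiableOn ℂ z {z | 0 < z.im})
    (hxT : ∀ t : ℂ, 0 < t.im → x (t + 1) = y t) (hyT : ∀ t : ℂ, 0 < t.im → y (t + 1) = x t)
    (hzT : ∀ t : ℂ, 0 < t.im → z (t + 1) = z t)
    (hxS : ∀ t : ℂ, 0 < t.im → x (-1 / t) = t ^ 2 * x t)
    (hyS : ∀ t : ℂ, 0 < t.im → y (-1 / t) = t ^ 2 * z t)
    (hzS : ∀ t : ℂ, 0 < t.im → z (-1 / t) = t ^ 2 * y t)
    (hx0 : Tendsto x (comap im atTop) (𝓝 0)) (hy0 : Tendsto y (comap im atTop) (𝓝 0))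
    (hz0 : Tendsto z (comap im atTop) (𝓝 0)) {t : ℂ} (ht : 0 < t.im) :
    x t = 0 ∧ y t = 0 ∧ z t = 0 := by
  have h1 : x t + y t + z t = 0 := by
    refine eq_zero_of_transform (f := fun t ↦ x t + y t + z t) (k := 2) (by norm_num) ?_
      (fun t ht ↦ ?_) (fun t ht ↦ ?_) ?_ ht
    · fun_prop
    · simp only [hxT t ht, hyT t ht, hzT t ht]; ring
    · simp only [hxS t ht, hyS t ht, hzS t ht]; ring
    · simpa using (hx0.add hy0).add hz0
  have h2 : x t * y t + y t * z t + z t * x t = 0 := by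
    refine eq_zero_of_transform (f := fun t ↦ x t * y t + y t * z t + z t * x t) (k := 4)
      (by norm_num) ?_ (fun t ht ↦ ?_) (fun t ht ↦ ?_) ?_ ht
    · fun_prop
    · simp only [hxT t ht, hyT t ht, hzT t ht]; ring
    · simp only [hxS t ht, hyS t ht, hzS t ht]; ring
    · simpa using ((hx0.mul hy0).add (hy0.mul hz0)).add (hz0.mul hx0)
  have h3 : x t * y t * z t = 0 := by
    refine eq_zero_of_transform (f := fun t ↦ x t * y t * z t) (k := 6)
      (by norm_num) ?_ (fun t ht ↦ ?_) (fun t ht ↦ ?_) ?_ ht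
    · fun_prop
    · simp only [hxT t ht, hyT t ht, hzT t ht]; ring
    · simp only [hxS t ht, hyS t ht, hzS t ht]; ring
    · simpa using (hx0.mul hy0).mul hz0
  have root (w : ℂ) (hw : w ^ 3 = 0) : w = 0 := by simpa using hw
  exact ⟨root _ (by linear_combination x t ^ 2 * h1 - x t * h2 + h3),
    root _ (by linear_combination y t ^ 2 * h1 - y t * h2 + h3),
    root _ (by linear_combination z t ^ 2 * h1 - z t * h2 + h3)⟩

/-- The derivative of a holomorphic function with a limit at `i∞` vanishes at `i∞`. -/
lemma tendsto_deriv_of_tendsto_comap_im {f : ℂ → ℂ} {l : ℂ}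
    (hd : DifferentiableOn ℂ f {z | 0 < z.im}) (hl : Tendsto f (comap im atTop) (𝓝 l)) :
    Tendsto (deriv f) (comap im atTop) (𝓝 0) := by
  rw [Metric.tendsto_nhds] at hl ⊢
  intro ε hε
  have h := hl (ε / 2) (by positivity)
  rw [eventually_comap, eventually_atTop] at h ⊢
  obtain ⟨B, hB⟩ := h
  refine ⟨max B 0 + 2, fun y hy t hty ↦ ?_⟩
  have hBt : B + 2 ≤ t.im ∧ 2 ≤ t.im := by
    subst hty
    constructor <;> linarith [le_max_left B 0, le_max_right B 0]
  have hball (z : ℂ) (hz : z ∈ Metric.closedBall t 1) : B ≤ z.im ∧ 0 < z.im := by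
    have h1 := (abs_im_le_norm (z - t)).trans (mem_closedBall_iff_norm.mp hz)
    rw [sub_im, abs_le] at h1
    constructor <;> linarith [h1.1]
  have hder : deriv f t = deriv (fun z ↦ f z - l) t := by simp
  have hdc : DiffContOnCl ℂ (fun z ↦ f z - l) (Metric.ball t 1) := by
    refine DifferentiableOn.diffContOnCl ?_
    rw [closure_ball t one_ne_zero]
    exact (hd.sub_const l).mono fun z hz ↦ (hball z hz).2
  have hle := norm_deriv_le_of_forall_mem_sphere_norm_le one_pos hdc (C := ε / 2) fun z hz ↦ by
    have := hB _ (hball z (Metric.sphere_subset_closedBall hz)).1 z rfl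
    rw [dist_eq_norm] at this
    exact this.le
  rw [dist_zero_right, hder]
  linarith

end LevelOne

section EisensteinTwo

open UpperHalfPlane hiding I im
open ModularGroup Complex Filter Topology MatrixGroups

lemma E2_eq_eisensteinSeries (z : ℍ) : E2 z = EisensteinSeries.E2 z := by
  rw [EisensteinSeries.E2_eq_tsum_cexp, E2,
    tsum_pnat_eq_tsum_succ (f := fun n ↦ (ArithmeticFunction.sigma 1 n : ℂ) *
      cexp (2 * Real.pi * I * z) ^ n)]
  congr 2
  refine tsum_congr fun n ↦ ?_
  rw [ArithmeticFunction.sigma_one_apply, ← Complex.exp_nat_mul]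
  push_cast
  congr 2
  ring

lemma differentiableOn_E2 : DifferentiableOn ℂ E2 {z | 0 < z.im} := by
  refine (UpperHalfPlane.mdifferentiable_iff.mp E2_mdifferentiable).congr fun z hz ↦ ?_
  simp [ofComplex_apply_of_im_pos hz, ← E2_eq_eisensteinSeries]

lemma E2_add_one (t : ℂ) : E2 (t + 1) = E2 t := by
  simp only [E2]
  congr 2
  refine tsum_congr fun n ↦ ?_
  congr 1
  rw [mul_add, Complex.exp_add]
  have h : cexp (2 * Real.pi * I * ((n : ℂ) + 1) * 1) = 1 := by
    have := Complex.exp_nat_mul_two_pi_mul_I (n + 1)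
    push_cast at this
    rwa [mul_one, mul_comm]
  rw [h, mul_one]

lemma E2_neg_one_div {t : ℂ} (ht : 0 < t.im) :
    E2 (-1 / t) = t ^ 2 * E2 t + 6 * t / (Real.pi * I) := by
  obtain ⟨z, rfl⟩ : ∃ z : ℍ, (z : ℂ) = t := ⟨⟨t, ht⟩, rfl⟩
  have h := congrFun (EisensteinSeries.E2_slash_action S) z
  have hz : (z : ℂ) ≠ 0 := z.ne_zero
  rw [ModularForm.SL_slash_apply, modular_S_smul] at h
  simp only [Pi.sub_apply, Pi.smul_apply, EisensteinSeries.D2_S, ← E2_eq_eisensteinSeries,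
    denom_S, riemannZeta_two, smul_eq_mul] at h
  have hpi : (Real.pi : ℂ) ≠ 0 := by exact_mod_cast Real.pi_ne_zero
  rw [show -1 / (z : ℂ) = (-(z : ℂ))⁻¹ by rw [neg_div, one_div, inv_neg]]
  simp at h ⊢
  field_simp at h ⊢
  linear_combination I * h - 6 * z * Complex.I_sq

lemma norm_cexp_mul_le {c : ℝ} (hc : 0 ≤ c) {t : ℂ} (ht : 1 ≤ t.im) :
    ‖cexp (2 * Real.pi * I * c * t)‖ ≤ ‖cexp (2 * Real.pi * I * c * I)‖ := by
  rw [Complex.norm_exp, Complex.norm_exp, Real.exp_le_exp]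
  simp
  nlinarith [mul_nonneg Real.pi_pos.le hc]

lemma tendsto_cexp_comap_im {c : ℝ} (hc : 0 < c) :
    Tendsto (fun t : ℂ ↦ cexp (2 * Real.pi * I * c * t)) (comap im atTop) (𝓝 0) := by
  rw [tendsto_zero_iff_norm_tendsto_zero]
  have h (t : ℂ) : ‖cexp (2 * Real.pi * I * c * t)‖ = Real.exp (-(2 * Real.pi * c * t.im)) := by
    rw [Complex.norm_exp]
    simp
  simp only [h]
  exact Real.tendsto_exp_neg_atTop_nhds_zero.comp
    (tendsto_comap.const_mul_atTop (by positivity))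

lemma eventually_le_im (y : ℝ) : ∀ᶠ t : ℂ in comap im atTop, y ≤ t.im :=
  tendsto_comap.eventually (eventually_ge_atTop y)

lemma tendsto_E2_comap_im : Tendsto E2 (comap im atTop) (𝓝 1) := by
  have hs : Summable fun n : ℕ ↦ ‖(∑ d ∈ Nat.divisors (n + 1), (d : ℂ)) *
      cexp (2 * Real.pi * I * ((n : ℂ) + 1) * I)‖ := by
    have h := (summable_nat_add_iff 1).mpr
      (EisensteinSeries.summable_sigma_mul_cexp_pow (k := 2) one_le_two UpperHalfPlane.I)
    refine (h.norm).congr fun n ↦ ?_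
    rw [ArithmeticFunction.sigma_one_apply, ← Complex.exp_nat_mul]
    push_cast
    congr 3
    ring
  have h := tendsto_tsum_of_dominated_convergence (𝓕 := comap im atTop)
    (f := fun (t : ℂ) (n : ℕ) ↦ (∑ d ∈ Nat.divisors (n + 1), (d : ℂ)) *
      cexp (2 * Real.pi * I * ((n : ℂ) + 1) * t)) (g := fun _ ↦ 0) hs (fun n ↦ ?_) ?_
  · change Tendsto (fun t ↦ 1 - 24 * ∑' n : ℕ, (∑ d ∈ Nat.divisors (n + 1), (d : ℂ)) *
      cexp (2 * Real.pi * I * ((n : ℂ) + 1) * t)) _ _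
    simpa using (h.const_mul 24).const_sub 1
  · simpa using (tendsto_cexp_comap_im (c := n + 1) (by positivity)).const_mul
      (∑ d ∈ Nat.divisors (n + 1), (d : ℂ))
  · filter_upwards [eventually_le_im 1] with t ht n
    rw [norm_mul, norm_mul]
    gcongr ?_ * ?_
    simpa using norm_cexp_mul_le (c := n + 1) (by positivity) ht

end EisensteinTwo

section Theta

open Complex Filter Topology

lemma theta3_eq_jacobiTheta₂ (t : ℂ) : theta3 t = jacobiTheta₂ 0 t :=
  tsum_congr fun n ↦ by simp [jacobiTheta₂_term]

lemma theta4_eq_jacobiTheta₂ (t : ℂ) : theta4 t = jacobiTheta₂ (1 / 2) t :=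
  tsum_congr fun n ↦ by
    rw [jacobiTheta₂_term, Complex.exp_add, ← Complex.exp_pi_mul_I, ← Complex.exp_int_mul]
    congr 2
    ring

lemma theta2_eq_jacobiTheta₂ (t : ℂ) :
    theta2 t = cexp (Real.pi * I * t / 4) * jacobiTheta₂ (t / 2) t := by
  rw [theta2, jacobiTheta₂, ← tsum_mul_left]
  refine tsum_congr fun n ↦ ?_
  rw [jacobiTheta₂_term, ← Complex.exp_add]
  congr 1
  ring

lemma cexp_pi_mul_I_mul_int (n : ℤ) : cexp (Real.pi * I * n) = (-1) ^ n := by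
  rw [← Complex.exp_pi_mul_I, ← Complex.exp_int_mul, mul_comm]

lemma cexp_pi_mul_I_mul_int_sq (n : ℤ) : cexp (Real.pi * I * (n : ℂ) ^ 2) = (-1) ^ n := by
  have h := cexp_pi_mul_I_mul_int (n ^ 2)
  push_cast at h
  rw [h, sq, zpow_mul]
  rcases n.even_or_odd with hn | hn
  · rw [hn.neg_one_zpow, one_zpow]
  · rw [hn.neg_one_zpow, hn.neg_one_zpow]

lemma theta3_add_one (t : ℂ) : theta3 (t + 1) = theta4 t :=
  tsum_congr fun n ↦ by
    rw [mul_add, Complex.exp_add, mul_one, cexp_pi_mul_I_mul_int_sq, mul_comm]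

lemma theta4_add_one (t : ℂ) : theta4 (t + 1) = theta3 t :=
  tsum_congr fun n ↦ by
    rw [mul_add, Complex.exp_add, mul_one, cexp_pi_mul_I_mul_int_sq, mul_left_comm,
      ← mul_zpow, neg_one_mul, neg_neg, one_zpow, mul_one]

lemma theta2_add_one (t : ℂ) : theta2 (t + 1) = cexp (Real.pi * I / 4) * theta2 t := by
  rw [theta2, theta2, ← tsum_mul_left]
  refine tsum_congr fun n ↦ ?_
  have h : cexp (Real.pi * I * (n ^ 2 + n)) = 1 := by
    rw [mul_add, Complex.exp_add, cexp_pi_mul_I_mul_int_sq, cexp_pi_mul_I_mul_int,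
      ← mul_zpow, neg_one_mul, neg_neg, one_zpow]
  rw [show Real.pi * I * ((n : ℂ) + 1 / 2) ^ 2 * (t + 1) = Real.pi * I * (n ^ 2 + n) +
    (Real.pi * I / 4 + Real.pi * I * ((n : ℂ) + 1 / 2) ^ 2 * t) by ring, Complex.exp_add, h,
    one_mul, Complex.exp_add]

lemma theta2_add_one_pow_four (t : ℂ) : theta2 (t + 1) ^ 4 = -theta2 t ^ 4 := by
  rw [theta2_add_one, mul_pow, ← Complex.exp_nat_mul]
  rw [show ((4 : ℕ) : ℂ) * (Real.pi * I / 4) = Real.pi * I by push_cast; ring,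
    Complex.exp_pi_mul_I, neg_one_mul]

lemma cpow_half_pow_four (t : ℂ) : ((-I * t) ^ (1 / 2 : ℂ)) ^ 4 = -t ^ 2 := by
  rw [show (4 : ℕ) = 2 * 2 from rfl, pow_mul, one_div, ← Nat.cast_ofNat (n := 2),
    Complex.cpow_nat_inv_pow _ two_ne_zero, mul_pow, neg_sq, I_sq, neg_one_mul]

lemma theta3_neg_one_div_pow_four {t : ℂ} (ht : 0 < t.im) :
    theta3 (-1 / t) ^ 4 = -t ^ 2 * theta3 t ^ 4 := by
  have h0 : t ≠ 0 := fun h ↦ by simp [h] at ht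
  have h := cpow_half_pow_four t
  have h1 : ((-I * t) ^ (1 / 2 : ℂ)) ≠ 0 := fun h2 ↦ by
    rw [h2, zero_pow four_ne_zero, eq_comm, neg_eq_zero] at h
    exact h0 (pow_eq_zero_iff two_ne_zero |>.mp h)
  rw [← h, theta3_eq_jacobiTheta₂ t, jacobiTheta₂_functional_equation, theta3_eq_jacobiTheta₂]
  simp
  field_simp

lemma theta2_neg_one_div_pow_four {t : ℂ} (ht : 0 < t.im) :
    theta2 (-1 / t) ^ 4 = -t ^ 2 * theta4 t ^ 4 := by
  have h0 : t ≠ 0 := fun h ↦ by simp [h] at ht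
  have h := cpow_half_pow_four t
  have h1 : ((-I * t) ^ (1 / 2 : ℂ)) ≠ 0 := fun h2 ↦ by
    rw [h2, zero_pow four_ne_zero, eq_comm, neg_eq_zero] at h
    exact h0 (pow_eq_zero_iff two_ne_zero |>.mp h)
  have h4 : theta4 t = 1 / (-I * t) ^ (1 / 2 : ℂ) * theta2 (-1 / t) := by
    rw [theta4_eq_jacobiTheta₂ t, jacobiTheta₂_functional_equation, theta2_eq_jacobiTheta₂,
      show -1 / t / 2 = -(1 / 2 / t) by ring, jacobiTheta₂_neg_left, ← mul_assoc]
    congr 3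
    ring
  rw [h4, ← h]
  field_simp

lemma im_neg_one_div_pos {t : ℂ} (ht : 0 < t.im) : 0 < (-1 / t).im := by
  have h : 0 < normSq t := normSq_pos.mpr fun h ↦ by simp [h] at ht
  rw [neg_div, one_div, neg_im, inv_im, neg_div, neg_neg]
  positivity

lemma theta4_neg_one_div_pow_four {t : ℂ} (ht : 0 < t.im) :
    theta4 (-1 / t) ^ 4 = -t ^ 2 * theta2 t ^ 4 := by
  have h0 : t ≠ 0 := fun h ↦ by simp [h] at ht
  have h := theta2_neg_one_div_pow_four (im_neg_one_div_pos ht)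
  rw [show -1 / (-1 / t) = t by field_simp] at h
  rw [h]
  field_simp

lemma differentiableAt_theta3 {t : ℂ} (ht : 0 < t.im) : DifferentiableAt ℂ theta3 t := by
  rw [funext theta3_eq_jacobiTheta₂]
  exact differentiableAt_jacobiTheta₂_snd _ ht

lemma differentiableAt_theta4 {t : ℂ} (ht : 0 < t.im) : DifferentiableAt ℂ theta4 t := by
  rw [funext theta4_eq_jacobiTheta₂]
  exact differentiableAt_jacobiTheta₂_snd _ ht

lemma differentiableAt_jacobiTheta₂_half {t : ℂ} (ht : 0 < t.im) :
    DifferentiableAt ℂ (fun t ↦ jacobiTheta₂ (t / 2) t) t :=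
  (hasFDerivAt_jacobiTheta₂ (t / 2) ht).differentiableAt.comp t
    (f := fun t : ℂ ↦ (t / 2, t)) (by fun_prop)

lemma differentiableAt_theta2 {t : ℂ} (ht : 0 < t.im) : DifferentiableAt ℂ theta2 t := by
  rw [funext theta2_eq_jacobiTheta₂]
  exact DifferentiableAt.mul (by fun_prop) (differentiableAt_jacobiTheta₂_half ht)

lemma tendsto_add_one_comap_im :
    Tendsto (fun t : ℂ ↦ t + 1) (comap im atTop) (comap im atTop) :=
  tendsto_comap_iff.mpr (tendsto_comap.congr fun t ↦ by simp)

lemma tendsto_theta3_comap_im : Tendsto theta3 (comap im atTop) (𝓝 1) := by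
  have h : Tendsto (fun t ↦ jacobiTheta t - 1) (comap im atTop) (𝓝 0) := by
    refine isBigO_at_im_infty_jacobiTheta_sub_one.trans_tendsto ?_
    simp only [neg_mul]
    exact Real.tendsto_exp_neg_atTop_nhds_zero.comp
      (tendsto_comap.const_mul_atTop Real.pi_pos)
  refine (tendsto_sub_nhds_zero_iff.mp h).congr fun t ↦ ?_
  rw [jacobiTheta_eq_jacobiTheta₂, theta3_eq_jacobiTheta₂]

lemma tendsto_theta4_comap_im : Tendsto theta4 (comap im atTop) (𝓝 1) :=
  (tendsto_theta3_comap_im.comp tendsto_add_one_comap_im).congr theta3_add_one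

lemma tendsto_jacobiTheta₂_half_comap_im :
    Tendsto (fun t ↦ jacobiTheta₂ (t / 2) t) (comap im atTop) (𝓝 2) := by
  have hterm (n : ℤ) (t : ℂ) : jacobiTheta₂_term n (t / 2) t =
      cexp (2 * Real.pi * I * (((n ^ 2 + n) / 2 : ℝ) : ℂ) * t) := by
    rw [jacobiTheta₂_term]
    congr 1
    push_cast
    ring
  have hnn (n : ℤ) : 0 ≤ n ^ 2 + n := by
    rcases le_or_gt 0 n with h | h <;> nlinarith
  have hnn' (n : ℤ) : (0 : ℝ) ≤ (n ^ 2 + n) / 2 := by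
    have : (0 : ℝ) ≤ (n : ℝ) ^ 2 + n := by exact_mod_cast hnn n
    positivity
  have h := tendsto_tsum_of_dominated_convergence (𝓕 := comap im atTop)
    (f := fun t n ↦ jacobiTheta₂_term n (t / 2) t)
    (g := fun n : ℤ ↦ if n ∈ ({0, -1} : Finset ℤ) then (1 : ℂ) else 0)
    (((summable_jacobiTheta₂_term_iff (I / 2) I).mpr (by simp)).norm) (fun n ↦ ?_) ?_
  · rw [tsum_eq_sum (s := {0, -1}) fun n hn ↦ if_neg hn, Finset.sum_ite_mem,
      Finset.inter_self] at h
    simpa [jacobiTheta₂, one_add_one_eq_two] using h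
  · split_ifs with hn
    · refine tendsto_const_nhds.congr fun t ↦ ?_
      rw [hterm]
      rcases Finset.mem_insert.mp hn with rfl | hn
      · simp
      · rw [Finset.mem_singleton.mp hn]
        simp
    · simp only [hterm]
      refine tendsto_cexp_comap_im ?_
      have h0 : n ≠ 0 := fun h ↦ hn (by simp [h])
      have h1 : n ≠ -1 := fun h ↦ hn (by simp [h])
      have : 0 < n ^ 2 + n := by
        rcases lt_trichotomy 0 n with h | h | h
        · nlinarith
        · exact absurd h.symm h0
        · have : n ≤ -2 := by omega
          nlinarith
      have : (0 : ℝ) < (n : ℝ) ^ 2 + n := by exact_mod_cast this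
      positivity
  · filter_upwards [eventually_le_im 1] with t ht n
    simp only [hterm]
    exact norm_cexp_mul_le (hnn' n) ht

lemma theta2_pow_four (t : ℂ) : theta2 t ^ 4 =
    cexp (Real.pi * I * t) * jacobiTheta₂ (t / 2) t ^ 4 := by
  rw [theta2_eq_jacobiTheta₂, mul_pow, ← Complex.exp_nat_mul]
  congr 2
  push_cast
  ring

lemma tendsto_theta2_pow_four_comap_im :
    Tendsto (fun t ↦ theta2 t ^ 4) (comap im atTop) (𝓝 0) := by
  have h := (tendsto_cexp_comap_im (c := 1 / 2) (by norm_num)).mul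
    (tendsto_jacobiTheta₂_half_comap_im.pow 4)
  rw [zero_mul] at h
  refine h.congr fun t ↦ ?_
  rw [theta2_pow_four]
  congr 2
  push_cast
  ring

/-- Jacobi's identity. -/
lemma theta3_pow_four {t : ℂ} (ht : 0 < t.im) :
    theta3 t ^ 4 = theta4 t ^ 4 + theta2 t ^ 4 := by
  have h := eq_zero_of_transform (k := 4)
    (f := fun t ↦ (theta3 t ^ 4 - theta4 t ^ 4 - theta2 t ^ 4) ^ 2) (by norm_num)
    (fun s hs ↦ DifferentiableAt.differentiableWithinAt <|
      ((((differentiableAt_theta3 hs).pow 4).sub ((differentiableAt_theta4 hs).pow 4)).sub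
        ((differentiableAt_theta2 hs).pow 4)).pow 2)
    (fun s hs ↦ by
      simp only [theta3_add_one, theta4_add_one, theta2_add_one_pow_four]
      ring)
    (fun s hs ↦ by
      simp only [theta3_neg_one_div_pow_four hs, theta4_neg_one_div_pow_four hs,
        theta2_neg_one_div_pow_four hs]
      ring)
    (by
      simpa using (((tendsto_theta3_comap_im.pow 4).sub (tendsto_theta4_comap_im.pow 4)).sub
        tendsto_theta2_pow_four_comap_im).pow 2) ht
  linear_combination (pow_eq_zero_iff two_ne_zero).mp h

lemma theta_ne_zero {t : ℂ} (ht : 0 < t.im) :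
    theta3 t ≠ 0 ∧ theta4 t ≠ 0 ∧ theta2 t ≠ 0 := by
  have h := ne_zero_of_transform_twelve
    (f := fun t ↦ (theta3 t ^ 4 * theta4 t ^ 4 * theta2 t ^ 4) ^ 2)
    (fun s hs ↦ DifferentiableAt.differentiableWithinAt <|
      ((((differentiableAt_theta3 hs).pow 4).mul ((differentiableAt_theta4 hs).pow 4)).mul
        ((differentiableAt_theta2 hs).pow 4)).pow 2)
    (fun s hs ↦ by
      simp only [theta3_add_one, theta4_add_one, theta2_add_one_pow_four]
      ring)
    (fun s hs ↦ by
      simp only [theta3_neg_one_div_pow_four hs, theta4_neg_one_div_pow_four hs,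
        theta2_neg_one_div_pow_four hs]
      ring)
    (by
      simpa using (((tendsto_theta3_comap_im.pow 4).mul (tendsto_theta4_comap_im.pow 4)).mul
        tendsto_theta2_pow_four_comap_im).pow 2)
    (by
      have h : ∀ᶠ s : ℂ in comap im atTop,
          theta3 s ≠ 0 ∧ theta4 s ≠ 0 ∧ jacobiTheta₂ (s / 2) s ≠ 0 ∧ 1 ≤ s.im :=
        (tendsto_theta3_comap_im.eventually_ne one_ne_zero).and <|
          (tendsto_theta4_comap_im.eventually_ne one_ne_zero).and <|
          (tendsto_jacobiTheta₂_half_comap_im.eventually_ne two_ne_zero).and (eventually_le_im 1)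
      have : (comap im atTop).NeBot := atTop_neBot.comap_of_surj im_surjective
      obtain ⟨s, h3, h4, h2, hs⟩ := h.exists
      refine ⟨s, by linarith, ?_⟩
      simp [theta2_eq_jacobiTheta₂, h2, h3, h4]) ht
  refine ⟨?_, ?_, ?_⟩ <;> intro h' <;> simp [h'] at h

end Theta

section DifferentialEquations

open Complex Filter Topology

lemma deriv_neg_one_div {f g : ℂ → ℂ} {g' t : ℂ} (ht : 0 < t.im)
    (h : ∀ s : ℂ, 0 < s.im → f (-1 / s) = g s) (hf : DifferentiableAt ℂ f (-1 / t))
    (hg : HasDerivAt g g' t) : deriv f (-1 / t) = t ^ 2 * g' := by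
  have h0 : t ≠ 0 := fun h ↦ by simp [h] at ht
  have h1 : HasDerivAt (fun s : ℂ ↦ -1 / s) (1 / t ^ 2) t := by
    simpa [neg_div] using (hasDerivAt_inv h0).fun_neg
  have h2 : HasDerivAt (fun s ↦ f (-1 / s)) (deriv f (-1 / t) * (1 / t ^ 2)) t :=
    hf.hasDerivAt.comp t h1
  have h3 := h2.unique (hg.congr_of_eventuallyEq <|
    Filter.mem_of_superset ((isOpen_lt continuous_const continuous_im).mem_nhds ht) h)
  rw [← h3]
  field_simp

lemma logDeriv_neg_one_div {f g : ℂ → ℂ} {t : ℂ} (ht : 0 < t.im)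
    (h : ∀ s : ℂ, 0 < s.im → f (-1 / s) = -s ^ 2 * g s) (hf : DifferentiableAt ℂ f (-1 / t))
    (hg : DifferentiableAt ℂ g t) (hg0 : g t ≠ 0) :
    logDeriv f (-1 / t) = 2 * t + t ^ 2 * logDeriv g t := by
  have h0 : t ≠ 0 := fun h ↦ by simp [h] at ht
  rw [logDeriv_apply, logDeriv_apply, h t ht,
    deriv_neg_one_div ht h hf (((hasDerivAt_pow 2 t).neg).mul hg.hasDerivAt)]
  simp only [Pi.neg_apply]
  field_simp
  push_cast
  ring

lemma logDeriv_add_one {f g : ℂ → ℂ} (h : ∀ s : ℂ, f (s + 1) = g s) (t : ℂ) :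
    logDeriv f (t + 1) = logDeriv g t := by
  rw [logDeriv_apply, logDeriv_apply, h, ← deriv_comp_add_const, funext h]

lemma logDeriv_theta3_pow_add_one (t : ℂ) :
    logDeriv (fun t ↦ theta3 t ^ 4) (t + 1) = logDeriv (fun t ↦ theta4 t ^ 4) t :=
  logDeriv_add_one (fun s ↦ by rw [theta3_add_one]) t

lemma logDeriv_theta4_pow_add_one (t : ℂ) :
    logDeriv (fun t ↦ theta4 t ^ 4) (t + 1) = logDeriv (fun t ↦ theta3 t ^ 4) t :=
  logDeriv_add_one (fun s ↦ by rw [theta4_add_one]) t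

lemma logDeriv_theta2_pow_add_one (t : ℂ) :
    logDeriv (fun t ↦ theta2 t ^ 4) (t + 1) = logDeriv (fun t ↦ theta2 t ^ 4) t := by
  rw [logDeriv_add_one (g := fun t ↦ -theta2 t ^ 4) theta2_add_one_pow_four, logDeriv_apply,
    logDeriv_apply, deriv.fun_neg, neg_div_neg_eq]

lemma differentiableOn_logDeriv {f : ℂ → ℂ} {s : Set ℂ} (hs : IsOpen s)
    (hf : DifferentiableOn ℂ f s) (h0 : ∀ t ∈ s, f t ≠ 0) : DifferentiableOn ℂ (logDeriv f) s :=
  (hf.deriv hs).div hf h0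

lemma tendsto_logDeriv_comap_im {f : ℂ → ℂ} {l : ℂ} (hf : DifferentiableOn ℂ f {z | 0 < z.im})
    (hl : Tendsto f (comap im atTop) (𝓝 l)) (h0 : l ≠ 0) :
    Tendsto (logDeriv f) (comap im atTop) (𝓝 0) := by
  have h := (tendsto_deriv_of_tendsto_comap_im hf hl).div hl h0
  rwa [zero_div] at h

lemma isOpen_im_pos : IsOpen {z : ℂ | 0 < z.im} :=
  isOpen_lt continuous_const continuous_im

lemma differentiableOn_theta3_pow :
    DifferentiableOn ℂ (fun t ↦ theta3 t ^ 4) {z | 0 < z.im} := fun _ ht ↦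
  ((differentiableAt_theta3 ht).pow 4).differentiableWithinAt

lemma differentiableOn_theta4_pow :
    DifferentiableOn ℂ (fun t ↦ theta4 t ^ 4) {z | 0 < z.im} := fun _ ht ↦
  ((differentiableAt_theta4 ht).pow 4).differentiableWithinAt

lemma differentiableOn_theta2_pow :
    DifferentiableOn ℂ (fun t ↦ theta2 t ^ 4) {z | 0 < z.im} := fun _ ht ↦
  ((differentiableAt_theta2 ht).pow 4).differentiableWithinAt

lemma tendsto_logDeriv_theta2_pow :
    Tendsto (logDeriv fun t ↦ theta2 t ^ 4) (comap im atTop) (𝓝 (Real.pi * I)) := by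
  have hd : DifferentiableOn ℂ (fun t ↦ jacobiTheta₂ (t / 2) t ^ 4) {z | 0 < z.im} := fun _ ht ↦
    ((differentiableAt_jacobiTheta₂_half ht).pow 4).differentiableWithinAt
  have h := (tendsto_logDeriv_comap_im hd (tendsto_jacobiTheta₂_half_comap_im.pow 4)
    (by norm_num)).const_add (Real.pi * I)
  rw [add_zero] at h
  refine h.congr' ?_
  filter_upwards [eventually_le_im 1] with t ht
  replace ht : 0 < t.im := by linarith
  have hne : jacobiTheta₂ (t / 2) t ≠ 0 := fun h ↦
    (theta_ne_zero ht).2.2 (by rw [theta2_eq_jacobiTheta₂, h, mul_zero])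
  have he : HasDerivAt (fun t : ℂ ↦ cexp (Real.pi * I * t))
      (cexp (Real.pi * I * t) * (Real.pi * I)) t := by
    simpa using ((hasDerivAt_id t).const_mul (Real.pi * I)).cexp
  rw [funext theta2_pow_four, logDeriv_mul (f := fun t ↦ cexp (Real.pi * I * t))
    (g := fun t ↦ jacobiTheta₂ (t / 2) t ^ 4) t (Complex.exp_ne_zero _)
    (pow_ne_zero 4 hne) he.differentiableAt (hd.differentiableAt (isOpen_im_pos.mem_nhds ht)),
    add_left_inj, logDeriv_apply, he.deriv, mul_div_cancel_left₀ _ (Complex.exp_ne_zero _)]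

lemma logDeriv_theta_pow_eq {t : ℂ} (ht : 0 < t.im) :
    3 / (Real.pi * I) * logDeriv (fun t ↦ theta3 t ^ 4) t
        = E2 t + (theta2 t ^ 4 - theta4 t ^ 4) ∧
      3 / (Real.pi * I) * logDeriv (fun t ↦ theta4 t ^ 4) t
        = E2 t - (theta3 t ^ 4 + theta2 t ^ 4) ∧
      3 / (Real.pi * I) * logDeriv (fun t ↦ theta2 t ^ 4) t
        = E2 t + (theta3 t ^ 4 + theta4 t ^ 4) := by
  have hpi : (Real.pi : ℂ) ≠ 0 := by exact_mod_cast Real.pi_ne_zero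
  have ha := differentiableOn_theta3_pow
  have hb := differentiableOn_theta4_pow
  have hc := differentiableOn_theta2_pow
  have hP := differentiableOn_E2
  have ha' := differentiableOn_logDeriv isOpen_im_pos ha
    fun s hs ↦ pow_ne_zero 4 (theta_ne_zero hs).1
  have hb' := differentiableOn_logDeriv isOpen_im_pos hb
    fun s hs ↦ pow_ne_zero 4 (theta_ne_zero hs).2.1
  have hc' := differentiableOn_logDeriv isOpen_im_pos hc
    fun s hs ↦ pow_ne_zero 4 (theta_ne_zero hs).2.2
  have la := tendsto_theta3_comap_im.pow 4
  have lb := tendsto_theta4_comap_im.pow 4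
  have lc := tendsto_theta2_pow_four_comap_im
  have lP := tendsto_E2_comap_im
  rw [one_pow] at la lb
  have la' := tendsto_logDeriv_comap_im ha la one_ne_zero
  have lb' := tendsto_logDeriv_comap_im hb lb one_ne_zero
  have lc' := tendsto_logDeriv_theta2_pow
  have h := eq_zero_of_permuted
    (x := fun t ↦ 3 / (Real.pi * I) * logDeriv (fun t ↦ theta3 t ^ 4) t
        - E2 t - (theta2 t ^ 4 - theta4 t ^ 4))
    (y := fun t ↦ 3 / (Real.pi * I) * logDeriv (fun t ↦ theta4 t ^ 4) t
        - E2 t + (theta3 t ^ 4 + theta2 t ^ 4))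
    (z := fun t ↦ 3 / (Real.pi * I) * logDeriv (fun t ↦ theta2 t ^ 4) t
        - E2 t - (theta3 t ^ 4 + theta4 t ^ 4))
    (((ha'.const_mul _).sub hP).sub (hc.sub hb)) (((hb'.const_mul _).sub hP).add (ha.add hc))
    (((hc'.const_mul _).sub hP).sub (ha.add hb))
    (fun s hs ↦ by
      simp only [E2_add_one, theta2_add_one_pow_four, theta4_add_one,
        logDeriv_theta3_pow_add_one]
      ring)
    (fun s hs ↦ by
      simp only [E2_add_one, theta2_add_one_pow_four, theta3_add_one,
        logDeriv_theta4_pow_add_one]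
      ring)
    (fun s hs ↦ by
      simp only [E2_add_one, theta3_add_one, theta4_add_one,
        logDeriv_theta2_pow_add_one]
      ring)
    (fun s hs ↦ by
      simp only [E2_neg_one_div hs, theta2_neg_one_div_pow_four hs,
        theta4_neg_one_div_pow_four hs,
        logDeriv_neg_one_div hs (fun s hs ↦ theta3_neg_one_div_pow_four hs :
            ∀ s, 0 < s.im → (fun t ↦ theta3 t ^ 4) (-1 / s) = -s ^ 2 * (fun t ↦ theta3 t ^ 4) s)
          (ha.differentiableAt (isOpen_im_pos.mem_nhds (im_neg_one_div_pos hs)))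
          (ha.differentiableAt (isOpen_im_pos.mem_nhds hs))
          (pow_ne_zero 4 (theta_ne_zero hs).1)]
      ring)
    (fun s hs ↦ by
      simp only [E2_neg_one_div hs, theta2_neg_one_div_pow_four hs,
        theta3_neg_one_div_pow_four hs,
        logDeriv_neg_one_div hs (fun s hs ↦ theta4_neg_one_div_pow_four hs :
            ∀ s, 0 < s.im → (fun t ↦ theta4 t ^ 4) (-1 / s) = -s ^ 2 * (fun t ↦ theta2 t ^ 4) s)
          (hb.differentiableAt (isOpen_im_pos.mem_nhds (im_neg_one_div_pos hs)))
          (hc.differentiableAt (isOpen_im_pos.mem_nhds hs))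
          (pow_ne_zero 4 (theta_ne_zero hs).2.2)]
      ring)
    (fun s hs ↦ by
      simp only [E2_neg_one_div hs, theta3_neg_one_div_pow_four hs,
        theta4_neg_one_div_pow_four hs,
        logDeriv_neg_one_div hs (fun s hs ↦ theta2_neg_one_div_pow_four hs :
            ∀ s, 0 < s.im → (fun t ↦ theta2 t ^ 4) (-1 / s) = -s ^ 2 * (fun t ↦ theta4 t ^ 4) s)
          (hc.differentiableAt (isOpen_im_pos.mem_nhds (im_neg_one_div_pos hs)))
          (hb.differentiableAt (isOpen_im_pos.mem_nhds hs))
          (pow_ne_zero 4 (theta_ne_zero hs).2.1)]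
      ring)
    (by simpa using ((la'.const_mul (3 / (Real.pi * I))).sub lP).sub (lc.sub lb))
    (by simpa using ((lb'.const_mul (3 / (Real.pi * I))).sub lP).add (la.add lc))
    (by
      have h := ((lc'.const_mul (3 / (Real.pi * I))).sub lP).sub (la.add lb)
      rw [div_mul_cancel₀ _ (mul_ne_zero hpi I_ne_zero)] at h
      norm_num at h
      exact h) ht
  obtain ⟨h1, h2, h3⟩ := h
  exact ⟨by linear_combination h1, by linear_combination h2, by linear_combination h3⟩

lemma tendsto_E2_comp_comap_im {g : ℂ → ℂ} (c : ℝ) (hc : 0 < c)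
    (hg : ∀ t : ℂ, (g t).im = c * t.im) :
    Tendsto (fun t ↦ E2 (g t)) (comap im atTop) (𝓝 1) :=
  tendsto_E2_comap_im.comp <| tendsto_comap_iff.mpr <|
    (tendsto_comap.const_mul_atTop hc).congr fun t ↦ (hg t).symm

lemma differentiableOn_E2_comp {g : ℂ → ℂ} (c : ℝ) (hc : 0 < c)
    (hg : ∀ t : ℂ, (g t).im = c * t.im) (hd : Differentiable ℂ g) :
    DifferentiableOn ℂ (fun t ↦ E2 (g t)) {z | 0 < z.im} :=
  differentiableOn_E2.comp hd.differentiableOn fun t ht ↦ by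
    simpa [hg] using mul_pos hc ht

lemma E2_half_add_one_neg_one_div {t : ℂ} (ht : 0 < t.im) :
    E2 ((-1 / t + 1) / 2) = t ^ 2 * E2 ((t + 1) / 2) + 12 * t / (Real.pi * I) := by
  have h0 : t ≠ 0 := fun h ↦ by simp [h] at ht
  have h1 : t - 1 ≠ 0 := fun h ↦ by simp [sub_eq_zero.mp h] at ht
  have hpi : (Real.pi : ℂ) ≠ 0 := by exact_mod_cast Real.pi_ne_zero
  have hv := E2_neg_one_div (t := (t - 1) / 2) (by simpa using ht)
  have hw := E2_neg_one_div (t := (-1 / t + 1) / 2) (by simpa using im_neg_one_div_pos ht)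
  have h2 : -1 / ((t - 1) / 2) = -1 / ((-1 / t + 1) / 2) + 1 + 1 := by
    have : -1 + t ≠ 0 := by rwa [neg_add_eq_sub]
    field_simp
    ring
  rw [h2, E2_add_one, E2_add_one, hw] at hv
  rw [show (t + 1) / 2 = (t - 1) / 2 + 1 by ring, E2_add_one]
  have hI := I_ne_zero
  have h3 : ((t - 1) / (2 * t)) ^ 2 * (E2 ((-1 / t + 1) / 2) -
      (t ^ 2 * E2 ((t - 1) / 2) + 12 * t / (Real.pi * I))) = 0 := by
    rw [show (-1 / t + 1) / 2 = (t - 1) / (2 * t) by field_simp; ring] at hv ⊢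
    linear_combination (norm := skip) hv
    field_simp
    ring
  rcases mul_eq_zero.mp h3 with h | h
  · simp [h0, h1] at h
  · exact sub_eq_zero.mp h

lemma E2_half_sub_add_E2_double {t : ℂ} (ht : 0 < t.im) :
    E2 (t / 2) - 2 * E2 t + 4 * E2 (2 * t) = 2 * E2 t + theta4 t ^ 4 - theta2 t ^ 4 := by
  have ha := differentiableOn_theta3_pow
  have hb := differentiableOn_theta4_pow
  have hc := differentiableOn_theta2_pow
  have hP := differentiableOn_E2
  have la := tendsto_theta3_comap_im.pow 4
  have lb := tendsto_theta4_comap_im.pow 4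
  have lc := tendsto_theta2_pow_four_comap_im
  have lP := tendsto_E2_comap_im
  rw [one_pow] at la lb
  have him1 (t : ℂ) : ((t + 1) / 2).im = 1 / 2 * t.im := by simp; ring
  have him2 (t : ℂ) : (t / 2).im = 1 / 2 * t.im := by simp; ring
  have him3 (t : ℂ) : (2 * t).im = 2 * t.im := by simp
  have h := eq_zero_of_permuted
    (x := fun t ↦ E2 ((t + 1) / 2) - 2 * E2 t - (theta2 t ^ 4 - theta4 t ^ 4))
    (y := fun t ↦ E2 (t / 2) - 2 * E2 t + (theta3 t ^ 4 + theta2 t ^ 4))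
    (z := fun t ↦ 4 * E2 (2 * t) - 2 * E2 t - (theta3 t ^ 4 + theta4 t ^ 4))
    (((differentiableOn_E2_comp _ (by norm_num) him1 (by fun_prop)).sub
      (hP.const_mul 2)).sub (hc.sub hb))
    (((differentiableOn_E2_comp _ (by norm_num) him2 (by fun_prop)).sub
      (hP.const_mul 2)).add (ha.add hc))
    ((((differentiableOn_E2_comp _ (by norm_num) him3 (by fun_prop)).const_mul 4).sub
      (hP.const_mul 2)).sub (ha.add hb))
    (fun s hs ↦ by
      simp only [theta2_add_one_pow_four, theta4_add_one, E2_add_one]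
      rw [show (s + 1 + 1) / 2 = s / 2 + 1 by ring, E2_add_one]
      ring)
    (fun s hs ↦ by
      simp only [theta2_add_one_pow_four, theta3_add_one, E2_add_one]
      ring)
    (fun s hs ↦ by
      simp only [theta3_add_one, theta4_add_one, E2_add_one]
      rw [show 2 * (s + 1) = 2 * s + 1 + 1 by ring, E2_add_one, E2_add_one]
      ring)
    (fun s hs ↦ by
      simp only [theta2_neg_one_div_pow_four hs, theta4_neg_one_div_pow_four hs,
        E2_neg_one_div hs, E2_half_add_one_neg_one_div hs]
      ring)
    (fun s hs ↦ by
      simp only [theta2_neg_one_div_pow_four hs, theta3_neg_one_div_pow_four hs,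
        E2_neg_one_div hs]
      rw [show -1 / s / 2 = -1 / (2 * s) by ring, E2_neg_one_div (by simpa using hs)]
      ring)
    (fun s hs ↦ by
      simp only [theta4_neg_one_div_pow_four hs, theta3_neg_one_div_pow_four hs,
        E2_neg_one_div hs]
      rw [show 2 * (-1 / s) = -1 / (s / 2) by ring, E2_neg_one_div (by simpa using hs)]
      ring)
    (by
      have h := ((tendsto_E2_comp_comap_im _ (by norm_num) him1).sub (lP.const_mul 2)).sub
        (lc.sub lb)
      norm_num at h
      exact h)
    (by
      have h := ((tendsto_E2_comp_comap_im _ (by norm_num) him2).sub (lP.const_mul 2)).add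
        (la.add lc)
      norm_num at h
      exact h)
    (by
      have h := (((tendsto_E2_comp_comap_im _ (by norm_num) him3).const_mul 4).sub
        (lP.const_mul 2)).sub (la.add lb)
      norm_num at h
      exact h) ht
  linear_combination h.2.1 + h.2.2

/-- Ramanujan's differential equation for `E2`, with `E4` expressed through theta constants. -/
lemma deriv_E2 {t : ℂ} (ht : 0 < t.im) :
    6 / (Real.pi * I) * deriv E2 t =
      E2 t ^ 2 - (theta3 t ^ 8 - theta4 t ^ 4 * theta2 t ^ 4) := by
  have ha := differentiableOn_theta3_pow
  have hb := differentiableOn_theta4_pow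
  have hc := differentiableOn_theta2_pow
  have hP := differentiableOn_E2
  have la := tendsto_theta3_comap_im.pow 4
  have lb := tendsto_theta4_comap_im.pow 4
  have lc := tendsto_theta2_pow_four_comap_im
  have lP := tendsto_E2_comap_im
  have h := eq_zero_of_transform (k := 4)
    (f := fun t ↦ 6 / (Real.pi * I) * deriv E2 t - E2 t ^ 2 +
      ((theta3 t ^ 4) ^ 2 - theta4 t ^ 4 * theta2 t ^ 4)) (by norm_num)
    ((((hP.deriv isOpen_im_pos).const_mul _).sub (hP.pow 2)).add ((ha.pow 2).sub (hb.mul hc)))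
    (fun s hs ↦ by
      have hdT : deriv E2 (s + 1) = deriv E2 s := by
        rw [← deriv_comp_add_const, funext E2_add_one]
      simp only [theta2_add_one_pow_four, theta3_add_one, theta4_add_one, E2_add_one, hdT,
        theta3_pow_four hs]
      ring)
    (fun s hs ↦ by
      have hdS := deriv_neg_one_div hs (fun s hs ↦ E2_neg_one_div hs)
        (hP.differentiableAt (isOpen_im_pos.mem_nhds (im_neg_one_div_pos hs)))
        (((hasDerivAt_pow 2 s).mul
          (hP.differentiableAt (isOpen_im_pos.mem_nhds hs)).hasDerivAt).add
          (((hasDerivAt_id s).const_mul 6).div_const (Real.pi * I)))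
      simp only [hdS, theta2_neg_one_div_pow_four hs, theta3_neg_one_div_pow_four hs,
        theta4_neg_one_div_pow_four hs, E2_neg_one_div hs]
      push_cast
      ring)
    (by
      have h := (((tendsto_deriv_of_tendsto_comap_im hP lP).const_mul (6 / (Real.pi * I))).sub
        (lP.pow 2)).add ((la.pow 2).sub (lb.mul lc))
      simpa using h) ht
  linear_combination h

end DifferentialEquations

section ThetaForms

open Complex Filter Topology

lemma deriv_sq_comp_two_mul {f : ℂ → ℂ} {τ : ℂ} (hf : DifferentiableAt ℂ f (2 * τ))
    (h0 : f (2 * τ) ≠ 0) :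
    deriv (fun s ↦ f (2 * s) ^ 2) τ = f (2 * τ) ^ 2 * logDeriv (fun t ↦ f t ^ 4) (2 * τ) := by
  have h2 : HasDerivAt (fun s : ℂ ↦ 2 * s) 2 τ := by
    simpa using (hasDerivAt_id τ).const_mul (2 : ℂ)
  have h := (hf.hasDerivAt.comp τ h2).fun_pow 2
  rw [logDeriv_apply, (hf.hasDerivAt.fun_pow 4).deriv]
  refine h.deriv.trans ?_
  simp only [Function.comp_apply]
  push_cast
  field_simp
  ring

lemma E4quasi_eq {τ : ℂ} (hτ : 0 < τ.im) :
    E4quasi τ = (2 * E2 (2 * τ) + theta4 (2 * τ) ^ 4 - theta2 (2 * τ) ^ 4) / 3 := by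
  rw [E4quasi, ← E2_half_sub_add_E2_double (by simpa using hτ)]
  congr 4
  · ring
  · ring

lemma deriv_E4quasi {τ : ℂ} (hτ : 0 < τ.im) :
    deriv E4quasi τ = 2 * (2 * deriv E2 (2 * τ)
      + theta4 (2 * τ) ^ 4 * logDeriv (fun t ↦ theta4 t ^ 4) (2 * τ)
      - theta2 (2 * τ) ^ 4 * logDeriv (fun t ↦ theta2 t ^ 4) (2 * τ)) / 3 := by
  have ht : 2 * τ ∈ {z : ℂ | 0 < z.im} := by simpa using hτ
  have hn := isOpen_im_pos.mem_nhds ht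
  have h2 : HasDerivAt (fun s : ℂ ↦ 2 * s) 2 τ := by
    simpa using (hasDerivAt_id τ).const_mul (2 : ℂ)
  have hP := (differentiableOn_E2.differentiableAt hn).hasDerivAt
  have hb := (differentiableOn_theta4_pow.differentiableAt hn).hasDerivAt
  have hc := (differentiableOn_theta2_pow.differentiableAt hn).hasDerivAt
  have h := ((((hP.const_mul 2).add hb).sub hc).div_const 3).comp τ h2
  have he := h.congr_of_eventuallyEq (f₁ := E4quasi)
    (Filter.mem_of_superset (isOpen_im_pos.mem_nhds hτ) fun s hs ↦ E4quasi_eq hs)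
  have hb0 := (theta_ne_zero ht).2.1
  have hc0 := (theta_ne_zero ht).2.2
  rw [he.deriv, logDeriv_apply, logDeriv_apply, mul_div_cancel₀ _ (pow_ne_zero 4 hb0),
    mul_div_cancel₀ _ (pow_ne_zero 4 hc0)]
  ring

end ThetaForms

theorem ramanujan_identities_Gamma0_four (τ : ℂ) (hτ : 0 < τ.im) :
    (1 / (2 * Real.pi * Complex.I)) * deriv A4form τ =
      (1 / 4) * A4form τ * (E4quasi τ + C4form τ ^ 2 - B4form τ ^ 2) ∧
    (1 / (2 * Real.pi * Complex.I)) * deriv B4form τ =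
      (1 / 4) * B4form τ * (E4quasi τ - A4form τ ^ 2) ∧
    (1 / (2 * Real.pi * Complex.I)) * deriv C4form τ =
      (1 / 4) * C4form τ * (E4quasi τ + A4form τ ^ 2) ∧
    (1 / (2 * Real.pi * Complex.I)) * deriv E4quasi τ =
      (1 / 4) * (E4quasi τ ^ 2 - A4form τ ^ 4) := by
  have ht : 0 < (2 * τ).im := by simpa using hτ
  obtain ⟨h3, h4, h2⟩ := theta_ne_zero ht
  obtain ⟨ha, hb, hc⟩ := logDeriv_theta_pow_eq ht
  have hJ := theta3_pow_four ht
  have hP := deriv_E2 ht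
  have hA : deriv A4form τ = _ := deriv_sq_comp_two_mul (differentiableAt_theta3 ht) h3
  have hB : deriv B4form τ = _ := deriv_sq_comp_two_mul (differentiableAt_theta4 ht) h4
  have hC : deriv C4form τ = _ := deriv_sq_comp_two_mul (differentiableAt_theta2 ht) h2
  rw [hA, hB, hC, deriv_E4quasi hτ, E4quasi_eq hτ]
  simp only [A4form, B4form, C4form]
  refine ⟨?_, ?_, ?_, ?_⟩
  · linear_combination theta3 (2 * τ) ^ 2 / 6 * ha
  · linear_combination theta4 (2 * τ) ^ 2 / 6 * hb + theta4 (2 * τ) ^ 2 / 12 * hJ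
  · linear_combination theta2 (2 * τ) ^ 2 / 6 * hc - theta2 (2 * τ) ^ 2 / 12 * hJ
  · linear_combination 1 / 9 * hP + theta4 (2 * τ) ^ 4 / 9 * hb - theta2 (2 * τ) ^ 4 / 9 * hc +
      (5 * theta3 (2 * τ) ^ 4 + theta4 (2 * τ) ^ 4 + theta2 (2 * τ) ^ 4) / 36 * hJ
end
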